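/- arXiv:2304.01368 — 3 statements merged into one kernel-verified Lean document; each statement's English description precedes it below -/
import Mathlib

section
/- Let k ≥ 1 and let G be a 3k-connected finite simple graph with n = |V(G)| ≥ 4k vertices that has a perfect matching. Then 2·𝓈(G) ≥ 3n + 2k (i.e., 𝓈(G) ≥ 3n/2 + k). -/
/-! Definitions for the slow coloring game (sum-color cost), paintability,
connectivity and auxiliary graphs. -/

variable {V : Type*}

/-- `D` is a maximal independent subset of `M` with respect to `G`:
`D ⊆ M`, `D` is independent in `G`, and every vertex of `M \ D` has a neighbor in `D`. -/
def SimpleGraph.MaxIndepSubset (G : SimpleGraph V) (M D : Finset V) : Prop :=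
  D ⊆ M ∧ (∀ u ∈ D, ∀ v ∈ D, ¬ G.Adj u v) ∧ ∀ v ∈ M, v ∉ D → ∃ u ∈ D, G.Adj u v

/-- Fueled recursion computing the slow coloring number of the subgraph of `G`
induced on the vertex set `A`.  In each round Lister marks a nonempty `M ⊆ A`,
scoring `|M|`, and Painter deletes a maximal independent subset `D` of `M`
(such a `D` is necessarily nonempty, so the game ends within `A.card` rounds;
hence the value is correct whenever the fuel is at least `A.card`). -/
noncomputable def SimpleGraph.slowAux [DecidableEq V] (G : SimpleGraph V) :
    ℕ → Finset V → ℕ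
  | 0, _ => 0
  | fuel + 1, A =>
    (A.powerset.filter fun M => M.Nonempty).sup fun M =>
      M.card + sInf {m | ∃ D : Finset V, G.MaxIndepSubset M D ∧ m = G.slowAux fuel (A \ D)}

/-- The slow coloring number (sum-color cost) `𝓈(G)` of a finite simple graph `G`. -/
noncomputable def SimpleGraph.sumColorCost [Fintype V] [DecidableEq V]
    (G : SimpleGraph V) : ℕ :=
  G.slowAux (Fintype.card V) Finset.univ

/-- `G` is `m`-connected: it has more than `m` vertices and deleting any set of
fewer than `m` vertices leaves a connected graph. -/
def SimpleGraph.MConnected [Fintype V] [DecidableEq V] (G : SimpleGraph V) (m : ℕ) : Prop :=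
  m < Fintype.card V ∧
    ∀ S : Finset V, S.card < m →
      (G.induce ((Finset.univ \ S : Finset V) : Set V)).Connected

/-- The independence number `α(G)`: the maximum size of a set of pairwise
nonadjacent vertices. -/
noncomputable def SimpleGraph.indepNumber (G : SimpleGraph V) : ℕ :=
  sSup {n | ∃ s : Set V, (∀ u ∈ s, ∀ v ∈ s, ¬ G.Adj u v) ∧ s.ncard = n}

/-- Fueled recursion for the `f`-painting game of `G` restricted to the vertex
set `A`: the empty graph is `f`-paintable, and a nonempty graph is `f`-paintable
iff every vertex has at least one token and, for every nonempty marked set `M`,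
Painter can delete some maximal independent subset `D` of `M` so that the rest
is paintable after each vertex of `M \ D` loses a token. -/
def SimpleGraph.paintAux [DecidableEq V] (G : SimpleGraph V) :
    ℕ → Finset V → (V → ℕ) → Prop
  | 0, A, _ => A = ∅
  | fuel + 1, A, f =>
    A = ∅ ∨ ((∀ v ∈ A, 1 ≤ f v) ∧
      ∀ M ⊆ A, M.Nonempty → ∃ D : Finset V, G.MaxIndepSubset M D ∧
        G.paintAux fuel (A \ D) (fun v => if v ∈ M \ D then f v - 1 else f v))

/-- `G` is `f`-paintable. -/
def SimpleGraph.Paintable [Fintype V] [DecidableEq V] (G : SimpleGraph V) (f : V → ℕ) : Prop :=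
  G.paintAux (Fintype.card V) Finset.univ f

/-- The sum-paintability `χ_SP(G)`: the least total number of tokens `∑ v, f v`
over functions `f` for which `G` is `f`-paintable. -/
noncomputable def SimpleGraph.sumPaintability [Fintype V] [DecidableEq V]
    (G : SimpleGraph V) : ℕ :=
  sInf {s | ∃ f : V → ℕ, G.Paintable f ∧ s = ∑ v, f v}

/-- The triangular prism graph on vertices `0,…,5` (a triangle `0,1,2`, a
triangle `3,4,5`, and the matching `03, 14, 25`). -/
def prismGraph : SimpleGraph (Fin 6) :=
  SimpleGraph.fromRel fun u v =>
    ((u : ℕ), (v : ℕ)) ∈ [(0,1), (1,2), (0,2), (3,4), (4,5), (3,5), (0,3), (1,4), (2,5)]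

/-- The star `K_{1,n-1}` on `n` vertices, with center `0`. -/
def starGraph (n : ℕ) : SimpleGraph (Fin n) :=
  SimpleGraph.fromRel fun u _ => (u : ℕ) = 0

namespace SlowC

set_option linter.unusedSectionVars false

variable {V : Type*} [Fintype V] [DecidableEq V]

/-- Lister can guarantee a score of at least `c` on the vertex set `A`. -/
inductive Win (G : SimpleGraph V) : Finset V → ℕ → Prop
  | zero (A : Finset V) : Win G A 0
  | step (A M : Finset V) (c : ℕ) (hM : M ⊆ A) (hne : M.Nonempty)
      (h : ∀ D : Finset V, G.MaxIndepSubset M D → Win G (A \ D) (c - M.card)) : Win G A c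

variable {G : SimpleGraph V}

lemma exists_maxIndep (G : SimpleGraph V) (M : Finset V) : ∃ D, G.MaxIndepSubset M D := by
  classical
  obtain ⟨D, hD, hmax⟩ := Finset.exists_max_image
    (M.powerset.filter fun D => ∀ u ∈ D, ∀ v ∈ D, ¬ G.Adj u v) Finset.card
    ⟨∅, by simp⟩
  simp only [Finset.mem_filter, Finset.mem_powerset] at hD hmax
  refine ⟨D, hD.1, hD.2, ?_⟩
  intro v hv hvD
  by_contra hcon
  push Not at hcon
  have := hmax (insert v D) ⟨Finset.insert_subset hv hD.1, by
    intro a ha b hb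
    rw [Finset.mem_insert] at ha hb
    rcases ha with rfl | ha <;> rcases hb with rfl | hb
    · simp
    · intro h; exact hcon b hb h.symm
    · exact hcon a ha
    · exact hD.2 a ha b hb⟩
  rw [Finset.card_insert_of_notMem hvD] at this
  omega

lemma maxIndep_nonempty {M D : Finset V} (h : G.MaxIndepSubset M D) (hM : M.Nonempty) :
    D.Nonempty := by
  obtain ⟨v, hv⟩ := hM
  by_cases hvD : v ∈ D
  · exact ⟨v, hvD⟩
  · obtain ⟨u, hu, _⟩ := h.2.2 v hv hvD
    exact ⟨u, hu⟩

lemma Win.le_slowAux {A : Finset V} {c : ℕ} (h : Win G A c) :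
    ∀ fuel, A.card ≤ fuel → c ≤ G.slowAux fuel A := by
  induction h with
  | zero A => intro _ _; exact Nat.zero_le _
  | step A M c hM hne _ ih =>
    intro fuel hf
    have hA : 0 < A.card := (hne.mono hM).card_pos
    obtain ⟨f, rfl⟩ : ∃ f, fuel = f + 1 := ⟨fuel - 1, by omega⟩
    rw [SimpleGraph.slowAux]
    have h1 : M ∈ A.powerset.filter fun M => M.Nonempty := by simp [hM, hne]
    refine le_trans ?_ (Finset.le_sup (f := fun M => M.card +
      sInf {m | ∃ D : Finset V, G.MaxIndepSubset M D ∧ m = G.slowAux f (A \ D)}) h1)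
    have hS : {m | ∃ D : Finset V, G.MaxIndepSubset M D ∧ m = G.slowAux f (A \ D)}.Nonempty := by
      obtain ⟨D, hD⟩ := exists_maxIndep G M
      exact ⟨_, D, hD, rfl⟩
    obtain ⟨D, hD, he⟩ := Nat.sInf_mem hS
    have hDne := maxIndep_nonempty hD hne
    have hcard : (A \ D).card ≤ f := by
      rw [Finset.card_sdiff_of_subset (hD.1.trans hM)]
      have := hDne.card_pos
      omega
    have := ih D hD f hcard
    rw [he]
    omega

lemma Win.anti {A : Finset V} {c : ℕ} (h : Win G A c) : ∀ c', c' ≤ c → Win G A c' := by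
  induction h with
  | zero A => intro c' h; obtain rfl : c' = 0 := by omega
              exact Win.zero A
  | step A M c hM hne _ ih =>
    intro c' h
    exact Win.step A M c' hM hne fun D hD => ih D hD _ (by omega)

lemma Win.mono {A : Finset V} {c : ℕ} (h : Win G A c) : ∀ B, A ⊆ B → Win G B c := by
  induction h with
  | zero A => intro B _; exact Win.zero B
  | step A M c hM hne _ ih =>
    intro B h
    exact Win.step B M c (hM.trans h) hne
      fun D hD => ih D hD _ (Finset.sdiff_subset_sdiff h (le_refl _))

lemma Win.add {A B : Finset V} {c c' : ℕ} (h : Win G A c) (hB : Win G B c') :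
    Disjoint A B → Win G (A ∪ B) (c + c') := by
  induction h with
  | zero A => intro _; rw [zero_add]; exact hB.mono _ Finset.subset_union_right
  | step A M c hM hne _ ih =>
    intro hd
    refine Win.step _ M _ (hM.trans Finset.subset_union_left) hne fun D hD => ?_
    have h1 := ih D hD (hd.mono_left Finset.sdiff_subset)
    refine (h1.anti (c + c' - M.card) (by omega)).mono _ ?_
    intro v hv
    have hDA := hD.1.trans hM
    rw [Finset.disjoint_left] at hd
    simp only [Finset.mem_union, Finset.mem_sdiff] at hv ⊢
    rcases hv with hv | hv
    · exact ⟨Or.inl hv.1, hv.2⟩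
    · exact ⟨Or.inr hv, fun h => hd (hDA h) hv⟩

lemma win_single (v : V) : Win G {v} 1 :=
  Win.step _ {v} _ (le_refl _) (by simp) fun D _ => by simpa using Win.zero _

lemma win_card (A : Finset V) : Win G A A.card := by
  induction A using Finset.induction_on with
  | empty => exact Win.zero _
  | insert a s ha ih =>
    rw [Finset.card_insert_of_notMem ha, Finset.insert_eq, add_comm]
    exact (win_single a).add ih (by simpa using ha)

/-- excess -/
def Exc (G : SimpleGraph V) (A : Finset V) (e : ℕ) : Prop := Win G A (A.card + e)

lemma exc_zero (A : Finset V) : Exc G A 0 := win_card A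

lemma Exc.anti {A : Finset V} {e e' : ℕ} (h : Exc G A e) (he : e' ≤ e) : Exc G A e' :=
  Win.anti h _ (by omega)

lemma Exc.add {A B : Finset V} {e e' : ℕ} (h : Exc G A e) (h' : Exc G B e')
    (hd : Disjoint A B) : Exc G (A ∪ B) (e + e') := by
  have := Win.add h h' hd
  unfold Exc
  rw [Finset.card_union_of_disjoint hd]
  exact this.anti _ (by omega)

lemma Exc.mono {A B : Finset V} {e : ℕ} (h : Exc G A e) (hs : A ⊆ B) : Exc G B e := by
  have := h.add (exc_zero (G := G) (B \ A)) Finset.disjoint_sdiff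
  rwa [Finset.union_sdiff_of_subset hs, add_zero] at this

lemma exc_edge {u v : V} (h : G.Adj u v) : Exc G {u, v} 1 := by
  have hne := h.ne
  refine Win.step _ {u, v} _ (le_refl _) (by simp) fun D hD => ?_
  have hc : ({u, v} : Finset V).card = 2 := Finset.card_pair hne
  rw [hc]
  refine (win_card _).anti _ ?_
  have : (({u, v} : Finset V) \ D).Nonempty := by
    by_contra hcon
    rw [Finset.not_nonempty_iff_eq_empty, Finset.sdiff_eq_empty_iff_subset] at hcon
    exact hD.2.1 u (hcon (by simp)) v (hcon (by simp)) h
  have := this.card_pos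
  omega

lemma exc_star {c x y z : V} (hx : G.Adj c x) (hy : G.Adj c y) (hz : G.Adj c z)
    (hxy : x ≠ y) (hxz : x ≠ z) (hyz : y ≠ z) : Exc G {c, x, y, z} 2 := by
  have h1 := hx.ne
  have h2 := hy.ne
  have h3 := hz.ne
  have hc4 : ({c, x, y, z} : Finset V).card = 4 := by
    rw [Finset.card_insert_of_notMem, Finset.card_insert_of_notMem, Finset.card_pair hyz] <;>
      simp [*]
  have hc3 : ({c, x, y} : Finset V).card = 3 := by
    rw [Finset.card_insert_of_notMem, Finset.card_pair hxy]; simp [*]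
  refine Win.step _ {c, x, y} _ (by intro a; simp; tauto) (by simp) fun D hD => ?_
  rw [hc4, hc3]
  by_cases hcD : c ∈ D
  · have : ({x, y, z} : Finset V) ⊆ {c, x, y, z} \ D := by
      intro a ha
      have hadj : G.Adj c a := by
        simp only [Finset.mem_insert, Finset.mem_singleton] at ha
        rcases ha with rfl | rfl | rfl <;> assumption
      simp only [Finset.mem_sdiff]
      refine ⟨by simp at ha ⊢; tauto, fun h => hD.2.1 c hcD a h hadj⟩
    have hc : ({x, y, z} : Finset V).card = 3 := by
      rw [Finset.card_insert_of_notMem, Finset.card_pair hyz]; simp [*]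
    exact ((win_card _).anti 3 hc.ge).mono _ this
  · have hzD : z ∉ D := by
      intro h
      have := hD.1 h
      simp at this
      rcases this with h | h | h
      · exact h3 h.symm
      · exact hxz h.symm
      · exact hyz h.symm
    have : ({c, z} : Finset V) ⊆ {c, x, y, z} \ D := by
      intro a ha
      simp only [Finset.mem_insert, Finset.mem_singleton] at ha
      rcases ha with rfl | rfl <;> simp [*]
    have he := exc_edge hz
    unfold Exc at he
    rw [Finset.card_pair h3] at he
    exact he.mono _ this


/-- `f` is (the involution of) a matching of `G` inside `A`. -/
def IsM (G : SimpleGraph V) (A : Finset V) (f : V → V) : Prop :=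
  (∀ v, f (f v) = v) ∧ ∀ v, f v ≠ v → v ∈ A ∧ G.Adj v (f v)

/-- vertices covered by the matching -/
def supp (f : V → V) : Finset V := Finset.univ.filter fun v => f v ≠ v

lemma mem_supp {f : V → V} {v : V} : v ∈ supp f ↔ f v ≠ v := by simp [supp]

lemma IsM.supp_sub {A : Finset V} {f : V → V} (h : IsM G A f) : supp f ⊆ A :=
  fun v hv => (h.2 v (mem_supp.1 hv)).1

lemma IsM.map_supp {A : Finset V} {f : V → V} (h : IsM G A f) {v : V} (hv : v ∈ supp f) :
    f v ∈ supp f := by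
  rw [mem_supp] at *
  rw [h.1 v]
  exact fun h => hv h.symm

lemma IsM.inj {A : Finset V} {f : V → V} (h : IsM G A f) : Function.Injective f := by
  intro a b hab
  rw [← h.1 a, ← h.1 b, hab]

lemma isM_id (A : Finset V) : IsM G A id := ⟨fun _ => rfl, fun v h => absurd rfl h⟩

lemma supp_id : supp (id : V → V) = ∅ := by
  ext v; simp [mem_supp]

lemma IsM.mono {A B : Finset V} {f : V → V} (h : IsM G A f) (hs : A ⊆ B) : IsM G B f :=
  ⟨h.1, fun v hv => ⟨hs (h.2 v hv).1, (h.2 v hv).2⟩⟩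

lemma IsM.sub {A B : Finset V} {f : V → V} (h : IsM G A f) (hs : supp f ⊆ B) : IsM G B f :=
  ⟨h.1, fun v hv => ⟨hs (mem_supp.2 hv), (h.2 v hv).2⟩⟩

/-- add the edge `xy` -/
def addE (f : V → V) (x y : V) : V → V := fun v => if v = x then y else if v = y then x else f v

lemma IsM.addE {A : Finset V} {f : V → V} (h : IsM G A f) {x y : V} (hx : x ∈ A) (hy : y ∈ A)
    (hfx : f x = x) (hfy : f y = y) (hadj : G.Adj x y) : IsM G A (addE f x y) := by
  have hne := hadj.ne
  constructor
  · intro v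
    by_cases h1 : v = x
    · simp [SlowC.addE, h1, hne.symm]
    by_cases h2 : v = y
    · simp [SlowC.addE, h2, hne.symm]
    have h3 : f v ≠ x := fun h3 => h1 (by rw [← h.1 v, h3, hfx])
    have h4 : f v ≠ y := fun h3 => h2 (by rw [← h.1 v, h3, hfy])
    simp [SlowC.addE, h1, h2, h3, h4, h.1 v]
  · intro v hv
    by_cases h1 : v = x
    · subst h1; simp [SlowC.addE, hx, hadj]
    by_cases h2 : v = y
    · subst h2; simp [SlowC.addE, hy, hadj.symm, hne.symm]
    simp only [SlowC.addE, h1, h2, if_false] at hv ⊢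
    exact h.2 v hv

lemma supp_addE {f : V → V} {x y : V} (hne : x ≠ y) :
    supp (addE f x y) = insert x (insert y (supp f)) := by
  ext v
  by_cases h1 : v = x
  · subst h1; simp [mem_supp, addE, hne.symm]
  by_cases h2 : v = y
  · subst h2; simp [mem_supp, addE, hne, hne.symm]
  simp [mem_supp, addE, h1, h2]

lemma card_supp_addE {f : V → V} {x y : V} (hne : x ≠ y) (hx : f x = x) (hy : f y = y) :
    (supp (addE f x y)).card = (supp f).card + 2 := by
  rw [supp_addE hne, Finset.card_insert_of_notMem, Finset.card_insert_of_notMem] <;>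
    simp [mem_supp, hx, hy, hne]

/-- remove the edge at `x` -/
def rmE (f : V → V) (x : V) : V → V := fun v => if v = x ∨ v = f x then v else f v

lemma IsM.rmE {A : Finset V} {f : V → V} (h : IsM G A f) (x : V) : IsM G A (rmE f x) := by
  constructor
  · intro v
    by_cases h1 : v = x ∨ v = f x
    · simp [SlowC.rmE, h1]
    · have h2 : ¬ (f v = x ∨ f v = f x) := by
        rintro (h2 | h2)
        · exact h1 (Or.inr (by rw [← h2, h.1]))
        · exact h1 (Or.inl (h.inj h2))
      simp [SlowC.rmE, h1, h2, h.1]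
  · intro v hv
    by_cases h1 : v = x ∨ v = f x
    · simp [SlowC.rmE, h1] at hv
    · simp only [SlowC.rmE, h1, if_false] at hv ⊢
      exact h.2 v hv

lemma supp_rmE {f : V → V} {x : V} : supp (rmE f x) = supp f \ {x, f x} := by
  ext v
  by_cases h1 : v = x ∨ v = f x
  · simp [mem_supp, rmE, h1]
  · simp only [mem_supp, rmE, h1, if_false, Finset.mem_sdiff, Finset.mem_insert,
      Finset.mem_singleton, not_false_eq_true, and_true]

lemma IsM.card_supp_rmE {A : Finset V} {f : V → V} (h : IsM G A f) {x : V} (hx : f x ≠ x) :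
    (supp (SlowC.rmE f x)).card + 2 = (supp f).card := by
  have hs : ({x, f x} : Finset V) ⊆ supp f := by
    intro v hv
    simp only [Finset.mem_insert, Finset.mem_singleton] at hv
    rcases hv with rfl | rfl
    · exact mem_supp.2 hx
    · exact h.map_supp (mem_supp.2 hx)
  have hc := Finset.card_pair (Ne.symm hx)
  have := Finset.card_le_card hs
  rw [supp_rmE, Finset.card_sdiff_of_subset hs]
  omega

lemma rmE_self {f : V → V} {x : V} : rmE f x x = x := by simp [rmE]
lemma rmE_f {f : V → V} {x : V} : rmE f x (f x) = f x := by simp [rmE]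
lemma rmE_fix {f : V → V} {x v : V} (h : f v = v) : rmE f x v = v := by simp [rmE, h]

lemma IsM.exc_aux (n : ℕ) : ∀ {A : Finset V} {f : V → V}, IsM G A f → (supp f).card = n →
    ∃ m, n = 2 * m ∧ Exc G (supp f) m := by
  induction n using Nat.strong_induction_on with
  | _ n ih =>
    intro A f h hn
    by_cases h0 : supp f = ∅
    · refine ⟨0, ?_, exc_zero _⟩
      rw [← hn, h0]; rfl
    · obtain ⟨x, hx⟩ := Finset.nonempty_iff_ne_empty.2 h0
      rw [mem_supp] at hx
      have hc := h.card_supp_rmE hx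
      obtain ⟨m, hm, he⟩ := ih (supp (SlowC.rmE f x)).card (by omega) (h.rmE x) rfl
      refine ⟨m + 1, by omega, ?_⟩
      have h1 := he.add (exc_edge (h.2 x hx).2) (by rw [supp_rmE]; exact Finset.sdiff_disjoint)
      refine h1.mono ?_
      rw [supp_rmE]
      apply Finset.union_subset Finset.sdiff_subset
      intro v hv
      simp only [Finset.mem_insert, Finset.mem_singleton] at hv
      rcases hv with rfl | rfl
      · exact mem_supp.2 hx
      · exact h.map_supp (mem_supp.2 hx)

lemma IsM.exc {A : Finset V} {f : V → V} (h : IsM G A f) :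
    ∃ m, (supp f).card = 2 * m ∧ Exc G (supp f) m := IsM.exc_aux _ h rfl

open Classical in
/-- matching number of `G[A]` -/
noncomputable def nu (G : SimpleGraph V) (A : Finset V) : ℕ :=
  (Finset.univ.filter fun f : V → V => IsM G A f).sup fun f => (supp f).card / 2

lemma IsM.le_nu {A : Finset V} {f : V → V} (h : IsM G A f) : (supp f).card ≤ 2 * nu G A := by
  classical
  obtain ⟨m, hm, _⟩ := h.exc
  have : (supp f).card / 2 ≤ nu G A := by
    unfold nu
    exact Finset.le_sup (f := fun f : V → V => (supp f).card / 2) (by simpa using h)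
  omega

lemma exists_nu (G : SimpleGraph V) (A : Finset V) :
    ∃ f, IsM G A f ∧ (supp f).card = 2 * nu G A := by
  classical
  have hne : (Finset.univ.filter fun f : V → V => IsM G A f).Nonempty :=
    ⟨id, by simpa using isM_id A⟩
  obtain ⟨f, hf, he⟩ := Finset.exists_mem_eq_sup _ hne fun f : V → V => (supp f).card / 2
  simp only [Finset.mem_filter, Finset.mem_univ, true_and] at hf
  refine ⟨f, hf, ?_⟩
  obtain ⟨m, hm, _⟩ := hf.exc
  have h2 : nu G A = (supp f).card / 2 := by
    unfold nu; convert he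
  omega

lemma exc_nu (G : SimpleGraph V) (A : Finset V) : Exc G A (nu G A) := by
  obtain ⟨f, hf, hc⟩ := exists_nu G A
  obtain ⟨m, hm, he⟩ := hf.exc
  obtain rfl : m = nu G A := by omega
  exact he.mono hf.supp_sub

lemma nu_mono {A B : Finset V} (h : A ⊆ B) : nu G A ≤ nu G B := by
  obtain ⟨f, hf, hc⟩ := exists_nu G A
  have := (hf.mono h).le_nu
  omega

lemma nu_insert_le (A : Finset V) (x : V) : nu G (insert x A) ≤ nu G A + 1 := by
  obtain ⟨f, hf, hc⟩ := exists_nu G (insert x A)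
  by_cases hx : f x = x
  · have h1 : IsM G A f := hf.sub fun v hv => by
      have := hf.supp_sub hv
      rw [Finset.mem_insert] at this
      rcases this with rfl | h
      · exact absurd hx (mem_supp.1 hv)
      · exact h
    have := h1.le_nu
    omega
  · have h1 : IsM G A (rmE f x) := (hf.rmE x).sub fun v hv => by
      rw [supp_rmE] at hv
      have := hf.supp_sub (Finset.mem_sdiff.1 hv).1
      rw [Finset.mem_insert] at this
      rcases this with rfl | h
      · simp at hv
      · exact h
    have := h1.le_nu
    have := hf.card_supp_rmE hx
    omega

/-- maximum matching -/
def IsMax (G : SimpleGraph V) (A : Finset V) (f : V → V) : Prop :=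
  IsM G A f ∧ (supp f).card = 2 * nu G A

lemma IsMax.not_adj {A : Finset V} {f : V → V} (h : IsMax G A f) {x y : V} (hx : x ∈ A)
    (hy : y ∈ A) (hfx : f x = x) (hfy : f y = y) : ¬ G.Adj x y := by
  intro hadj
  have := (h.1.addE hx hy hfx hfy hadj).le_nu
  rw [card_supp_addE hadj.ne hfx hfy] at this
  have := h.2
  omega

lemma IsMax.no_aug {A : Finset V} {f : V → V} (h : IsMax G A f) {x y z : V} (hx : x ∈ A)
    (hy : y ∈ A) (hfx : f x = x) (hfy : f y = y) (hxy : x ≠ y) (hz : f z ≠ z)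
    (h1 : G.Adj x (f z)) (h2 : G.Adj y z) : False := by
  have hzA : z ∈ A := (h.1.2 z hz).1
  have hfzA : f z ∈ A := h.1.supp_sub (h.1.map_supp (mem_supp.2 hz))
  have g1 := h.1.rmE z
  have c1 := h.1.card_supp_rmE hz
  have g2 := g1.addE hx hfzA (rmE_fix hfx) rmE_f h1
  have c2 := card_supp_addE h1.ne (rmE_fix (x := z) hfx) rmE_f
  have hzx : z ≠ x := fun e => hz (by rw [e, hfx])
  have hzy : z ≠ y := fun e => hz (by rw [e, hfy])
  have hfzy : f z ≠ y := fun e => hz (by rw [e, ← hfy, ← e, h.1.1]; )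
  have e1 : addE (rmE f z) x (f z) y = y := by
    simp [addE, hxy.symm, hfzy.symm, rmE_fix hfy]
  have e2 : addE (rmE f z) x (f z) z = z := by
    simp [addE, hzx, hz.symm, rmE_self]
  have g3 := g2.addE hy hzA e1 e2 h2
  have c3 := card_supp_addE h2.ne e1 e2
  have := g3.le_nu
  have := h.2
  omega

lemma exists_isM_of_inj (A L : Finset V) (g : V → V) (hg : Set.InjOn g L)
    (hLA : ∀ v ∈ L, v ∈ A ∧ g v ∈ A ∧ G.Adj v (g v)) (hd : ∀ v ∈ L, ∀ u ∈ L, g v ≠ u) :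
    ∃ f, IsM G A f ∧ supp f = L ∪ L.image g := by
  induction L using Finset.induction_on with
  | empty => exact ⟨id, isM_id A, by simp [supp_id]⟩
  | insert a s ha ih =>
    obtain ⟨f, hf, hs⟩ := ih (hg.mono (by simp)) (fun v hv => hLA v (by simp [hv]))
      (fun v hv u hu => hd v (by simp [hv]) u (by simp [hu]))
    obtain ⟨h1, h2, h3⟩ := hLA a (by simp)
    have e1 : f a = a := by
      by_contra h
      have := mem_supp.2 h
      rw [hs, Finset.mem_union, Finset.mem_image] at this
      rcases this with h | ⟨v, hv, h⟩
      · exact ha h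
      · exact hd v (by simp [hv]) a (by simp) h
    have e2 : f (g a) = g a := by
      by_contra h
      have := mem_supp.2 h
      rw [hs, Finset.mem_union, Finset.mem_image] at this
      rcases this with h | ⟨v, hv, h⟩
      · exact hd a (by simp) (g a) (by simp [h]) rfl
      · have := hg (by simp [hv]) (by simp) h
        exact ha (this ▸ hv)
    refine ⟨addE f a (g a), hf.addE h1 h2 e1 e2 h3, ?_⟩
    rw [supp_addE h3.ne, hs]
    ext v
    simp only [Finset.mem_insert, Finset.mem_union, Finset.mem_image]
    constructor
    · rintro (h | h | h | ⟨u, hu, h⟩)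
      · simp [h]
      · exact Or.inr ⟨a, Or.inl rfl, h.symm⟩
      · simp [h]
      · exact Or.inr ⟨u, Or.inr hu, h⟩
    · rintro ((h | h) | ⟨u, hu | hu, h⟩)
      · simp [h]
      · simp [h]
      · subst hu; simp [h]
      · exact Or.inr (Or.inr (Or.inr ⟨u, hu, h⟩))

lemma card_of_inj {L : Finset V} {g : V → V} (hg : Set.InjOn g L)
    (hd : ∀ v ∈ L, ∀ u ∈ L, g v ≠ u) : (L ∪ L.image g).card = 2 * L.card := by
  rw [Finset.card_union_of_disjoint, Finset.card_image_of_injOn hg]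
  · omega
  · rw [Finset.disjoint_right]
    intro v hv hv'
    obtain ⟨u, hu, rfl⟩ := Finset.mem_image.1 hv
    exact hd u hu _ hv' rfl

lemma le_nu_of_inj {A L : Finset V} {g : V → V} (hg : Set.InjOn g L)
    (hLA : ∀ v ∈ L, v ∈ A ∧ g v ∈ A ∧ G.Adj v (g v)) (hd : ∀ v ∈ L, ∀ u ∈ L, g v ≠ u) :
    L.card ≤ nu G A := by
  obtain ⟨f, hf, hs⟩ := exists_isM_of_inj A L g hg hLA hd
  have := hf.le_nu
  rw [hs, card_of_inj hg hd] at this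
  omega

/-- Covering an independent set by a maximum matching. -/
lemma cov (Z B : Finset V) (N : V → Finset V) (hN : ∀ v u, u ∈ N v ↔ G.Adj v u)
    (hBZ : B ⊆ Z) (hind : ∀ u ∈ B, ∀ v ∈ B, ¬ G.Adj u v)
    (hdeg : ∀ w ∈ B, B.card ≤ (N w ∩ Z).card) :
    ∃ f, IsMax G Z f ∧ B ⊆ supp f := by
  classical
  obtain ⟨f0, hf0⟩ := exists_nu G Z
  obtain ⟨f, hf, hmax⟩ := Finset.exists_max_image
    (Finset.univ.filter fun f : V → V => IsMax G Z f) (fun f => (supp f ∩ B).card)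
    ⟨f0, by simp only [Finset.mem_filter, Finset.mem_univ, true_and]; exact hf0⟩
  simp only [Finset.mem_filter, Finset.mem_univ, true_and] at hf hmax
  refine ⟨f, hf, ?_⟩
  intro w hw
  by_contra hws
  have hfw : f w = w := by rw [mem_supp] at hws; simpa using hws
  have key : ∀ y ∈ N w ∩ Z, f y ≠ y ∧ f y ∈ B := by
    intro y hy
    rw [Finset.mem_inter, hN] at hy
    have h1 : f y ≠ y := fun h => hf.not_adj (hBZ hw) hy.2 hfw h hy.1
    refine ⟨h1, ?_⟩
    by_contra h2
    have hyB : y ∉ B := fun h => hind w hw y h hy.1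
    have g2 := (hf.1.rmE y).addE (hBZ hw) hy.2 (rmE_fix hfw) rmE_self hy.1
    have c2 := card_supp_addE hy.1.ne (rmE_fix (x := y) hfw) rmE_self
    have c1 := hf.1.card_supp_rmE h1
    have := hmax _ ⟨g2, by rw [c2, c1, hf.2]⟩
    have h3 : insert w (supp f ∩ B) ⊆ supp (addE (rmE f y) w y) ∩ B := by
      intro v hv
      rw [supp_addE hy.1.ne, supp_rmE]
      simp only [Finset.mem_insert, Finset.mem_inter, Finset.mem_sdiff, Finset.mem_singleton] at hv ⊢
      rcases hv with rfl | ⟨h4, h5⟩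
      · exact ⟨Or.inl rfl, hw⟩
      · refine ⟨Or.inr (Or.inr ⟨h4, ?_⟩), h5⟩
        rintro (rfl | rfl)
        · exact hyB h5
        · exact h2 h5
    have h4 := Finset.card_le_card h3
    rw [Finset.card_insert_of_notMem (by simp [hws])] at h4
    omega
  have h5 : (N w ∩ Z).image f ⊆ B.erase w := by
    intro v hv
    obtain ⟨y, hy, rfl⟩ := Finset.mem_image.1 hv
    rw [Finset.mem_erase]
    refine ⟨fun h => ?_, (key y hy).2⟩
    apply (key y hy).1
    rw [h, ← hf.1.1 y, h, hfw]
  have h6 := Finset.card_le_card h5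
  rw [Finset.card_image_of_injective _ hf.1.inj, Finset.card_erase_of_mem hw] at h6
  have := hdeg w hw
  have := Finset.card_pos.2 ⟨w, hw⟩
  omega

lemma mindeg (X : Finset V) (N : V → Finset V) (hN : ∀ v u, u ∈ N v ↔ G.Adj v u) (e : ℕ)
    (hdeg : ∀ v ∈ X, e ≤ (N v ∩ X).card) (hX : 2 * nu G X + 2 ≤ X.card) : e ≤ nu G X := by
  obtain ⟨f, hf⟩ := exists_nu G X
  have hmax : IsMax G X f := hf
  have h1 : 1 < (X \ supp f).card := by
    rw [Finset.card_sdiff_of_subset hf.1.supp_sub]; omega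
  obtain ⟨x, hx, y, hy, hxy⟩ := Finset.one_lt_card.1 h1
  simp only [Finset.mem_sdiff, mem_supp, not_not] at hx hy
  have sx : N x ∩ X ⊆ supp f := by
    intro v hv
    rw [Finset.mem_inter, hN] at hv
    rw [mem_supp]
    exact fun h => hmax.not_adj hx.1 hv.2 hx.2 h hv.1
  have sy : N y ∩ X ⊆ supp f := by
    intro v hv
    rw [Finset.mem_inter, hN] at hv
    rw [mem_supp]
    exact fun h => hmax.not_adj hy.1 hv.2 hy.2 h hv.1
  have hd : Disjoint ((N x ∩ X).image f) (N y ∩ X) := by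
    rw [Finset.disjoint_left]
    intro v hv hv'
    obtain ⟨u, hu, rfl⟩ := Finset.mem_image.1 hv
    have hus := sx hu
    rw [Finset.mem_inter, hN] at hu hv'
    exact hmax.no_aug hy.1 hx.1 hy.2 hx.2 hxy.symm (mem_supp.1 hus) hv'.1 hu.1
  have hsub : (N x ∩ X).image f ∪ (N y ∩ X) ⊆ supp f := by
    apply Finset.union_subset _ sy
    intro v hv
    obtain ⟨u, hu, rfl⟩ := Finset.mem_image.1 hv
    exact hf.1.map_supp (sx hu)
  have := Finset.card_le_card hsub
  rw [Finset.card_union_of_disjoint hd, Finset.card_image_of_injective _ hf.1.inj] at this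
  have := hdeg x hx.1
  have := hdeg y hy.1
  omega

lemma exc_leaf (x : V) (T : Finset V) (hT : ∀ u ∈ T, G.Adj x u) (i : ℕ)
    (hc : T.card = 1 + 2 * i) (hi : i ≤ 1) : Exc G (insert x T) (1 + i) := by
  obtain rfl | rfl : i = 0 ∨ i = 1 := by omega
  · obtain ⟨a, rfl⟩ := Finset.card_eq_one.1 hc
    exact exc_edge (hT a (by simp))
  · obtain ⟨a, b, c, h1, h2, h3, rfl⟩ := Finset.card_eq_three.1 hc
    exact exc_star (hT a (by simp)) (hT b (by simp)) (hT c (by simp)) h1 h2 h3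

lemma star_step (x : V) (T Q Lp C : Finset V) (hT : ∀ u ∈ T, G.Adj x u) (i e0 : ℕ)
    (hc : T.card = 1 + 2 * i) (hi : i ≤ 1) (hQ : Exc G Q e0) (hQC : Disjoint Q C)
    (hCL : Disjoint C Lp) (hx : x ∈ C) (hTL : T ⊆ Lp \ Q) :
    Exc G (Q ∪ insert x T) (e0 + (1 + i)) ∧ Disjoint (Q ∪ insert x T) (C.erase x) ∧
    ((Q ∪ insert x T) ∩ Lp).card = (Q ∩ Lp).card + (1 + 2 * i) := by
  rw [Finset.disjoint_left] at hQC hCL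
  have hTm : ∀ u ∈ T, u ∈ Lp ∧ u ∉ Q := fun u hu => Finset.mem_sdiff.1 (hTL hu)
  refine ⟨hQ.add (exc_leaf x T hT i hc hi) ?_, ?_, ?_⟩
  · rw [Finset.disjoint_left]
    intro a ha ha'
    rcases Finset.mem_insert.1 ha' with rfl | h
    · exact hQC ha hx
    · exact (hTm a h).2 ha
  · rw [Finset.disjoint_left]
    intro a ha ha'
    have haC := Finset.mem_of_mem_erase ha'
    rcases Finset.mem_union.1 ha with h | h
    · exact hQC h haC
    rcases Finset.mem_insert.1 h with rfl | h
    · simp at ha'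
    · exact hCL haC (hTm a h).1
  · have : (Q ∪ insert x T) ∩ Lp = (Q ∩ Lp) ∪ T := by
      ext a
      simp only [Finset.mem_inter, Finset.mem_union, Finset.mem_insert]
      constructor
      · rintro ⟨h | rfl | h, h'⟩
        · exact Or.inl ⟨h, h'⟩
        · exact absurd h' (hCL hx)
        · exact Or.inr h
      · rintro (h | h)
        · exact ⟨Or.inl h.1, h.2⟩
        · exact ⟨Or.inr (Or.inr h), (hTm a h).1⟩
    rw [this, Finset.card_union_of_disjoint, hc]
    rw [Finset.disjoint_left]
    intro a ha ha'
    exact (hTm a ha').2 (Finset.mem_inter.1 ha).1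

lemma star_lemma (N : V → Finset V) (hN : ∀ v u, u ∈ N v ↔ G.Adj v u) (Lp : Finset V)
    (ep : V → ℕ) (n : ℕ) : ∀ (C Q : Finset V) (e0 i : ℕ), C.card = n → Exc G Q e0 →
    Disjoint Q C → Disjoint C Lp → (C = ∅ ∨ ∑ x ∈ C, ep x < C.card) → i ≤ C.card →
    (∀ x ∈ C, (Q ∩ Lp).card + C.card + 2 * i ≤ (N x ∩ Lp).card + ep x) →
    ∃ Q', Q' ⊆ Q ∪ C ∪ Lp ∧ (Q' ∩ Lp).card = (Q ∩ Lp).card + C.card + 2 * i ∧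
      Exc G Q' (e0 + C.card + i) := by
  induction n with
  | zero =>
    intro C Q e0 i hC hQ _ _ _ hi _
    refine ⟨Q, ?_, by omega, hQ.anti (by omega)⟩
    intro a ha; simp [ha]
  | succ n ih =>
    intro C Q e0 i hC hQ hQC hCL hsum hi hdeg
    have hne : C.Nonempty := Finset.card_pos.1 (by omega)
    have hsum : ∑ x ∈ C, ep x < C.card := by
      rcases hsum with h | h
      · exact absurd h hne.ne_empty
      · exact h
    obtain ⟨x, hx, hxs⟩ : ∃ x ∈ C, 1 ≤ ep x ∨ ∑ x ∈ C, ep x = 0 := by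
      by_cases h : ∑ x ∈ C, ep x = 0
      · obtain ⟨x, hx⟩ := hne
        exact ⟨x, hx, Or.inr h⟩
      · obtain ⟨x, hx, h⟩ := Finset.exists_ne_zero_of_sum_ne_zero h
        exact ⟨x, hx, Or.inl (by omega)⟩
    have hle : ep x ≤ ∑ x ∈ C, ep x := Finset.single_le_sum (fun _ _ => Nat.zero_le _) hx
    have hes := Finset.sum_erase_add C ep hx
    have hce := Finset.card_erase_of_mem hx
    have hd := hdeg x hx
    have havail : (N x ∩ Lp).card ≤ ((N x ∩ Lp) \ Q).card + (Q ∩ Lp).card := by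
      have h1 := Finset.card_sdiff_add_card_inter (N x ∩ Lp) Q
      have h2 : (N x ∩ Lp) ∩ Q ⊆ Q ∩ Lp := by
        intro a; simp only [Finset.mem_inter]; tauto
      have := Finset.card_le_card h2
      omega
    obtain ⟨i0, hi0, hi0i, hi1⟩ : ∃ i0, i0 ≤ 1 ∧ i0 ≤ i ∧ i - i0 ≤ n := by
      by_cases h : i = 0
      · exact ⟨0, by omega, by omega, by omega⟩
      · exact ⟨1, by omega, by omega, by omega⟩
    obtain ⟨T, hT, hTc⟩ := Finset.exists_subset_card_eq
      (s := (N x ∩ Lp) \ Q) (n := 1 + 2 * i0) (by omega)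
    have hT1 : ∀ u ∈ T, G.Adj x u := fun u hu => by
      have := hT hu
      simp only [Finset.mem_sdiff, Finset.mem_inter, hN] at this
      exact this.1.1
    have hT2 : T ⊆ Lp \ Q := fun u hu => by
      have := hT hu
      simp only [Finset.mem_sdiff, Finset.mem_inter] at this ⊢
      exact ⟨this.1.2, this.2⟩
    obtain ⟨s1, s2, s3⟩ := star_step x T Q Lp C hT1 i0 e0 hTc hi0 hQ hQC hCL hx hT2
    obtain ⟨Q', q1, q2, q3⟩ := ih (C.erase x) _ _ (i - i0) (by omega) s1 s2
      (hCL.mono_left (Finset.erase_subset _ _)) (by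
        rcases Nat.eq_zero_or_pos n with h0 | h0
        · left; exact Finset.card_eq_zero.1 (by omega)
        · right
          omega) (by omega) (by
        intro y hy
        have := hdeg y (Finset.mem_of_mem_erase hy)
        omega)
    refine ⟨Q', ?_, by omega, q3.anti (by omega)⟩
    intro a ha
    have := q1 ha
    simp only [Finset.mem_union, Finset.mem_insert, Finset.mem_erase] at this ⊢
    rcases this with ((h | rfl | h) | h) | h
    · simp [h]
    · simp [hx]
    · right; exact (Finset.mem_sdiff.1 (hT2 h)).1
    · simp [h.2]
    · simp [h]

lemma def_hall (L : Finset V) (t : V → Finset V) :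
    ∃ S ⊆ L, ∃ L' ⊆ L, ∃ g : V → V, Set.InjOn g L' ∧ (∀ v ∈ L', g v ∈ t v) ∧
      L.card + (S.biUnion t).card ≤ L'.card + S.card := by
  classical
  obtain ⟨S, hS, hmax⟩ := Finset.exists_max_image L.powerset
    (fun S => (S.card : ℤ) - ((S.biUnion t).card : ℤ)) ⟨∅, by simp⟩
  rw [Finset.mem_powerset] at hS
  have h0 := hmax ∅ (by simp)
  simp only [Finset.card_empty, Finset.biUnion_empty, Nat.cast_zero, sub_zero] at h0
  obtain ⟨d, hd⟩ : ∃ d, S.card = (S.biUnion t).card + d := ⟨S.card - (S.biUnion t).card, by omega⟩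
  let t' : L → Finset (V ⊕ Fin d) := fun v => (t v).disjSum Finset.univ
  have hall : ∀ s : Finset L, s.card ≤ (s.biUnion t').card := by
    intro s
    rcases s.eq_empty_or_nonempty with rfl | ⟨a, ha⟩
    · simp
    have h1 := hmax (s.image Subtype.val) (by
      rw [Finset.mem_powerset]
      intro v hv
      obtain ⟨u, _, rfl⟩ := Finset.mem_image.1 hv
      exact u.2)
    rw [Finset.card_image_of_injective _ Subtype.val_injective] at h1
    have h2 : (((s.image Subtype.val).biUnion t).disjSum (Finset.univ : Finset (Fin d))) ⊆
        s.biUnion t' := by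
      intro x hx
      rw [Finset.mem_biUnion]
      rcases x with x | x
      · rw [Finset.inl_mem_disjSum, Finset.mem_biUnion] at hx
        obtain ⟨u, hu, hx⟩ := hx
        obtain ⟨w, hw, rfl⟩ := Finset.mem_image.1 hu
        exact ⟨w, hw, by simpa [t'] using hx⟩
      · exact ⟨a, ha, by simp [t']⟩
    have h3 := Finset.card_le_card h2
    rw [Finset.card_disjSum, Finset.card_univ, Fintype.card_fin] at h3
    omega
  obtain ⟨h, hinj, hmem⟩ := (Finset.all_card_le_biUnion_card_iff_exists_injective t').1 hall
  let g : V → V := fun v => if hv : v ∈ L then (h ⟨v, hv⟩).elim id (fun _ => v) else v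
  have hg : ∀ (v : V) (hv : v ∈ L), (∃ u, h ⟨v, hv⟩ = Sum.inl u) → h ⟨v, hv⟩ = Sum.inl (g v) := by
    rintro v hv ⟨u, hu⟩
    simp [g, hv, hu]
  refine ⟨S, hS, L.filter fun v => ∃ hv : v ∈ L, ∃ u, h ⟨v, hv⟩ = Sum.inl u,
    Finset.filter_subset _ _, g, ?_, ?_, ?_⟩
  · intro a ha b hb hab
    simp only [Finset.coe_filter, Set.mem_ofPred_eq] at ha hb
    obtain ⟨_, ha, ha'⟩ := ha
    obtain ⟨_, hb, hb'⟩ := hb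
    have h1 := hg a ha ha'
    have h2 := hg b hb hb'
    rw [hab, ← h2] at h1
    exact congrArg Subtype.val (hinj h1)
  · intro v hv
    rw [Finset.mem_filter] at hv
    obtain ⟨_, hv, hv'⟩ := hv
    have h1 := hmem ⟨v, hv⟩
    rw [hg v hv hv'] at h1
    simpa [t'] using h1
  · have h1 : (L.attach.image h) ⊆
        ((L.filter fun v => ∃ hv : v ∈ L, ∃ u, h ⟨v, hv⟩ = Sum.inl u).image
          (fun v => (Sum.inl (g v) : V ⊕ Fin d))) ∪ Finset.univ.image Sum.inr := by
      intro x hx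
      obtain ⟨v, _, rfl⟩ := Finset.mem_image.1 hx
      rw [Finset.mem_union]
      rcases hh : h v with u | u
      · left
        rw [Finset.mem_image]
        refine ⟨v, ?_, ?_⟩
        · rw [Finset.mem_filter]; exact ⟨v.2, v.2, u, hh⟩
        · rw [← hg v v.2 ⟨u, hh⟩, ← hh]
      · right; simp
    have h2 := Finset.card_le_card h1
    rw [Finset.card_image_of_injective _ hinj, Finset.card_attach] at h2
    have h3 := Finset.card_union_le ((L.filter fun v => ∃ hv : v ∈ L, ∃ u,
      h ⟨v, hv⟩ = Sum.inl u).image (fun v => (Sum.inl (g v) : V ⊕ Fin d)))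
      (Finset.univ.image Sum.inr)
    have h4 : (Finset.univ.image (Sum.inr : Fin d → V ⊕ Fin d)).card ≤ d := by
      refine Finset.card_image_le.trans ?_
      simp
    have h5 : _ ≤ (L.filter fun v => ∃ hv : v ∈ L, ∃ u, h ⟨v, hv⟩ = Sum.inl u).card :=
      Finset.card_image_le (s := L.filter fun v => ∃ hv : v ∈ L, ∃ u, h ⟨v, hv⟩ = Sum.inl u)
        (f := fun v => (Sum.inl (g v) : V ⊕ Fin d))
    omega

lemma conn_closed {s : Set V} (h : (G.induce s).Connected) (P : V → Prop)
    (hP : ∀ u ∈ s, ∀ v ∈ s, G.Adj u v → P u → P v) {a b : V} (ha : a ∈ s) (hb : b ∈ s)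
    (hPa : P a) : P b := by
  obtain ⟨w⟩ := h.preconnected ⟨a, ha⟩ ⟨b, hb⟩
  have : ∀ (x y : s), (G.induce s).Walk x y → P x → P y := by
    intro x y w
    induction w with
    | nil => exact id
    | cons hadj _ ih => exact fun hx => ih (hP _ (Subtype.coe_prop _) _ (Subtype.coe_prop _) hadj hx)
  exact this _ _ w hPa

lemma cut_case (N : V → Finset V) (hN : ∀ v u, u ∈ N v ↔ G.Adj v u) (X D : Finset V) (k : ℕ)
    (hconn : G.MConnected (3 * k)) (hind : ∀ u ∈ D, ∀ v ∈ D, ¬ G.Adj u v)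
    (hnu : nu G X + nu G Xᶜ + 1 ≤ k) :
    Exc G (Finset.univ \ D) (2 * k) ∨
    (Finset.univ.filter fun v => v ∈ X ↔ v ∈ D).card < 3 * k ∨
    (Finset.univ.filter fun v => ¬ (v ∈ X ↔ v ∈ D)).card < 3 * k := by
  classical
  set W := Finset.univ.filter fun v => v ∈ X ↔ v ∈ D with hW
  have hWm : ∀ v, v ∈ W ↔ (v ∈ X ↔ v ∈ D) := by intro v; simp [hW]
  have hW2 : (Finset.univ.filter fun v => ¬ (v ∈ X ↔ v ∈ D)) = Wᶜ := by
    ext v; simp [hW]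
  rw [hW2]
  obtain ⟨S, hS, L, hL, g, hg, hgt, hcard⟩ := def_hall W fun v => N v \ W
  by_cases h3 : 3 * k ≤ L.card
  · left
    have hadj : ∀ v ∈ L, G.Adj v (g v) ∧ g v ∉ W ∧ v ∈ W := fun v hv => by
      have := hgt v hv
      rw [Finset.mem_sdiff, hN] at this
      exact ⟨this.1, this.2, hL hv⟩
    have hd : ∀ v ∈ L, ∀ u ∈ L, g v ≠ u := fun v hv u hu h =>
      (hadj v hv).2.1 (h ▸ (hadj u hu).2.2)
    have ha : (L.filter fun v => v ∈ D).card ≤ nu G X := by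
      refine le_nu_of_inj (g := g) (hg.mono (fun v hv => (Finset.mem_filter.1 hv).1)) ?_ ?_
      · intro v hv
        rw [Finset.mem_filter] at hv
        obtain ⟨h1, h2, h3⟩ := hadj v hv.1
        rw [hWm] at h2 h3
        have := hind v hv.2 (g v)
        refine ⟨h3.2 hv.2, ?_, h1⟩
        by_contra h4
        apply h2
        constructor
        · intro h; exact absurd h h4
        · intro h; exact absurd h1 (this h)
      · intro v hv u hu
        exact hd v (Finset.mem_filter.1 hv).1 u (Finset.mem_filter.1 hu).1
    have hb : ((L.filter fun v => v ∉ D).filter fun v => g v ∈ D).card ≤ nu G Xᶜ := by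
      refine le_nu_of_inj (g := g) (hg.mono ?_) ?_ ?_
      · intro v hv; simp at hv; exact hv.1.1
      · intro v hv
        simp only [Finset.mem_filter] at hv
        obtain ⟨h1, h2, h3⟩ := hadj v hv.1.1
        rw [hWm] at h2 h3
        simp only [Finset.mem_compl]
        tauto
      · intro v hv u hu
        simp only [Finset.mem_filter] at hv hu
        exact hd v hv.1.1 u hu.1.1
    set Lc := (L.filter fun v => v ∉ D).filter fun v => ¬ g v ∈ D with hLc
    have c1 := Finset.card_filter_add_card_filter_not (s := L) (fun v => v ∈ D)
    have c2 := Finset.card_filter_add_card_filter_not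
      (s := L.filter fun v => v ∉ D) (fun v => g v ∈ D)
    rw [← hLc] at c2
    have hLcm : ∀ v ∈ Lc, v ∈ L ∧ v ∉ D ∧ g v ∉ D := by
      intro v hv
      simp only [hLc, Finset.mem_filter] at hv
      tauto
    have hgc : Set.InjOn g Lc := hg.mono fun v hv => (hLcm v hv).1
    have hdc : ∀ v ∈ Lc, ∀ u ∈ Lc, g v ≠ u := fun v hv u hu =>
      hd v (hLcm v hv).1 u (hLcm u hu).1
    obtain ⟨f, hf, hfs⟩ := exists_isM_of_inj (G := G) (Finset.univ \ D) Lc g hgc (by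
      intro v hv
      obtain ⟨h1, h2, h3⟩ := hLcm v hv
      simp [h2, h3, (hadj v h1).1]) hdc
    obtain ⟨m, hm, he⟩ := hf.exc
    rw [hfs, card_of_inj hgc hdc] at hm
    exact (he.mono hf.supp_sub).anti (by omega)
  · right
    set T := (W \ S) ∪ S.biUnion fun v => N v \ W with hT
    have hTc : T.card < 3 * k := by
      have := Finset.card_union_le (W \ S) (S.biUnion fun v => N v \ W)
      rw [← hT, Finset.card_sdiff_of_subset hS] at this
      have := Finset.card_le_card hS
      omega
    have hc := hconn.2 T hTc
    by_cases h1 : W ⊆ T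
    · left; exact (Finset.card_le_card h1).trans_lt hTc
    by_cases h2 : Wᶜ ⊆ T
    · right; exact (Finset.card_le_card h2).trans_lt hTc
    exfalso
    rw [Finset.not_subset] at h1 h2
    obtain ⟨a, ha, haT⟩ := h1
    obtain ⟨b, hb, hbT⟩ := h2
    rw [Finset.mem_compl] at hb
    refine hb (conn_closed hc (fun v => v ∈ W) ?_ (a := a) (b := b) (by simp [haT])
      (by simp [hbT]) ha)
    intro u hu v hv huv huW
    by_contra hvW
    simp only [Finset.coe_sdiff, Finset.coe_univ, Set.mem_sdiff, Set.mem_univ, true_and,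
      Finset.mem_coe] at hu hv
    have huS : u ∈ S := by
      by_contra huS
      exact hu (by rw [hT, Finset.mem_union, Finset.mem_sdiff]; exact Or.inl ⟨huW, huS⟩)
    apply hv
    rw [hT, Finset.mem_union, Finset.mem_biUnion]
    right
    exact ⟨u, huS, by rw [Finset.mem_sdiff, hN]; exact ⟨huv, hvW⟩⟩

lemma card_inter_add {N A B : Finset V} (hd : Disjoint A B) :
    (N ∩ (A ∪ B)).card = (N ∩ A).card + (N ∩ B).card := by
  rw [Finset.inter_union_distrib_left, Finset.card_union_of_disjoint]
  exact hd.mono Finset.inter_subset_right Finset.inter_subset_right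

lemma card_supp_half {A K : Finset V} {f : V → V} (h : IsM G A f) (hK : K ⊆ supp f) :
    2 * K.card ≤ (supp f).card + (K.filter fun v => f v ∈ K).card := by
  have h1 : K.image f ⊆ supp f := by
    intro v hv
    obtain ⟨u, hu, rfl⟩ := Finset.mem_image.1 hv
    exact h.map_supp (hK hu)
  have h2 := Finset.card_union_add_card_inter K (K.image f)
  rw [Finset.card_image_of_injective _ h.inj] at h2
  have h3 := Finset.card_le_card (Finset.union_subset hK h1)
  have h4 : K ∩ K.image f ⊆ K.filter fun v => f v ∈ K := by
    intro v hv
    rw [Finset.mem_inter, Finset.mem_image] at hv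
    obtain ⟨hv, u, hu, rfl⟩ := hv
    rw [Finset.mem_filter, h.1]
    exact ⟨hv, hu⟩
  have := Finset.card_le_card h4
  omega

lemma card_indep_cov {A B : Finset V} {f : V → V} (h : IsM G A f) (hB : B ⊆ supp f)
    (hind : ∀ u ∈ B, ∀ v ∈ B, ¬ G.Adj u v) : 2 * B.card ≤ (supp f).card := by
  have h1 := card_supp_half h hB
  have h2 : (B.filter fun v => f v ∈ B) = ∅ := by
    rw [Finset.filter_eq_empty_iff]
    intro v hv hfv
    exact hind v hv _ hfv (h.2 v (mem_supp.1 (hB hv))).2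
  rw [h2] at h1
  simpa using h1

lemma IsMax.nbr_sub {A : Finset V} {f : V → V} (h : IsMax G A f) {N : V → Finset V}
    (hN : ∀ v u, u ∈ N v ↔ G.Adj v u) {x : V} (hx : x ∈ A) (hfx : f x = x) :
    N x ∩ A ⊆ supp f := by
  intro v hv
  rw [Finset.mem_inter, hN] at hv
  rw [mem_supp]
  exact fun h' => h.not_adj hx hv.2 hfx h' hv.1

/-- The structure of vertices with many neighbours inside `X`. -/
lemma bad_struct {N : V → Finset V} (hN : ∀ v u, u ∈ N v ↔ G.Adj v u) {X : Finset V}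
    {f : V → V} (hf : IsMax G X f) {z : V} (hz : z ∈ X)
    (hin : 2 * nu G X + 2 ≤ (N z ∩ X).card) :
    z ∈ supp f ∧ (∃ y ∈ X, f y = y ∧ G.Adj z y) ∧ ∀ x ∈ X, f x = x → ¬ G.Adj x (f z) := by
  have h1 : 1 < ((N z ∩ X) \ supp f).card := by
    have h2 := Finset.le_card_sdiff (supp f) (N z ∩ X)
    rw [hf.2] at h2
    omega
  obtain ⟨a, ha, b, hb, hab⟩ := Finset.one_lt_card.1 h1
  simp only [Finset.mem_sdiff, Finset.mem_inter, hN, mem_supp, not_not] at ha hb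
  have hzs : f z ≠ z := fun h => hf.not_adj hz ha.1.2 h ha.2 ha.1.1
  refine ⟨mem_supp.2 hzs, ⟨a, ha.1.2, ha.2, ha.1.1⟩, ?_⟩
  intro x hx hfx hadj
  by_cases hxa : x = a
  · exact hf.no_aug hx hb.1.2 hfx hb.2 (by rw [hxa]; exact hab) hzs hadj hb.1.1.symm
  · exact hf.no_aug hx ha.1.2 hfx ha.2 hxa hzs hadj ha.1.1.symm

lemma nu_erase_lt {N : V → Finset V} (hN : ∀ v u, u ∈ N v ↔ G.Adj v u) {X : Finset V}
    {z : V} (hz : z ∈ X) (hin : 2 * nu G X + 1 ≤ (N z ∩ X).card) :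
    nu G (X.erase z) + 1 ≤ nu G X := by
  by_contra hcon
  have h1 := nu_mono (G := G) (Finset.erase_subset z X)
  obtain ⟨f, hf, hc⟩ := exists_nu G (X.erase z)
  have hfm : IsMax G X f := ⟨hf.mono (Finset.erase_subset z X), by omega⟩
  have hfz : f z = z := by
    by_contra h
    have := hf.supp_sub (mem_supp.2 h)
    simp at this
  have := Finset.card_le_card (hfm.nbr_sub hN hz hfz)
  have := hfm.2
  omega

lemma nu_erase_lt' {N : V → Finset V} (hN : ∀ v u, u ∈ N v ↔ G.Adj v u) {Y B : Finset V}
    {w : V} (hBY : B ⊆ Y) (hind : ∀ u ∈ B, ∀ v ∈ B, ¬ G.Adj u v) (hw : w ∈ B)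
    (hdeg : ∀ w' ∈ B, B.card ≤ (N w' ∩ Y).card)
    (hin : 2 * nu G Y + 2 ≤ (N w ∩ Y).card + B.card) :
    nu G (Y.erase w) + 1 ≤ nu G Y := by
  by_contra hcon
  have h1 := nu_mono (G := G) (Finset.erase_subset w Y)
  have hBc := Finset.card_erase_of_mem hw
  have hBp := Finset.card_pos.2 ⟨w, hw⟩
  obtain ⟨f, ⟨hf, hc⟩, hcov⟩ := cov (G := G) (Y.erase w) (B.erase w) N hN
    (Finset.erase_subset_erase w hBY)
    (fun u hu v hv => hind u (Finset.mem_of_mem_erase hu) v (Finset.mem_of_mem_erase hv)) (by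
      intro w' hw'
      have hw'B := Finset.mem_of_mem_erase hw'
      have h2 := hdeg w' hw'B
      have h3 : N w' ∩ Y ⊆ N w' ∩ Y.erase w := by
        intro v hv
        rw [Finset.mem_inter, hN] at hv
        rw [Finset.mem_inter, hN, Finset.mem_erase]
        refine ⟨hv.1, ?_, hv.2⟩
        rintro rfl
        exact hind w' hw'B v hw hv.1
      have := Finset.card_le_card h3
      omega)
  have hfm : IsMax G Y f := ⟨hf.mono (Finset.erase_subset w Y), by omega⟩
  have hfw : f w = w := by
    by_contra h
    have := hf.supp_sub (mem_supp.2 h)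
    simp at this
  have h4 : N w ∩ Y ⊆ supp f \ B.erase w := by
    intro v hv
    rw [Finset.mem_sdiff]
    refine ⟨hfm.nbr_sub hN (hBY hw) hfw hv, fun h => ?_⟩
    rw [Finset.mem_inter, hN] at hv
    exact hind w hw v (Finset.mem_of_mem_erase h) hv.1
  have h5 := Finset.card_le_card h4
  rw [Finset.card_sdiff_of_subset hcov] at h5
  have := Finset.card_le_card hcov
  have := hfm.2
  omega

lemma nearX {N : V → Finset V} (hN : ∀ v u, u ∈ N v ↔ G.Adj v u) (p : V → V)
    (hp : ∀ v, p (p v) = v) (hpa : ∀ v, G.Adj v (p v)) (k : ℕ) (hdeg : ∀ v, 3 * k ≤ (N v).card)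
    (X Y : Finset V) (hY : ∀ v, v ∈ Y ↔ v ∉ X) (hXp : ∀ v, p v ∈ X ↔ v ∉ X)
    (f : V → V) (hf : IsMax G X f) (X' : Finset V) (hX' : X' ⊆ X) (hX's : ∀ x ∈ X', f x = x)
    (t : ℕ) (hjt : X'.card + t = k) (hm : nu G X + nu G Y + 1 ≤ k)
    (ht1 : t ≤ nu G X) (ht2 : t ≤ nu G Y) (ht3 : t = nu G X ∨ t = nu G Y)
    (D : Finset V) (hind : ∀ u ∈ D, ∀ v ∈ D, ¬ G.Adj u v)
    (hDX' : ∀ x ∈ X', x ∉ D ∧ p x ∉ D) (hsmall : (D ∩ Y).card + (X \ D).card < 3 * k)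
    (hflip : ∀ z ∈ X, nu G (X.erase z) + nu G (Y.erase (p z)) + 2 ≤ nu G X + nu G Y →
      (N z ∩ X).card + (N (p z) ∩ Y).card + 2 ≤ (N z ∩ Y).card + (N (p z) ∩ X).card) :
    ∃ e, Exc G (Finset.univ \ D) e ∧ 3 * k + D.card ≤ e + X.card + 2 * t := by
  classical
  have hpinj : Function.Injective p := fun a b h => by rw [← hp a, ← hp b, h]
  set B := D ∩ Y with hB
  set Lam := Y \ D with hLam
  set R := (X \ D) \ X' with hR
  set PB := B.image p with hPB
  set U := R \ PB with hU
  have mB : ∀ v, v ∈ B ↔ v ∈ D ∧ v ∉ X := by intro v; simp [hB, hY]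
  have mL : ∀ v, v ∈ Lam ↔ v ∉ D ∧ v ∉ X := by intro v; simp [hLam, hY]; tauto
  have mR : ∀ v, v ∈ R ↔ v ∈ X ∧ v ∉ D ∧ v ∉ X' := by intro v; simp [hR]; tauto
  have mPB : ∀ v, v ∈ PB ↔ p v ∈ B := by
    intro v
    rw [hPB, Finset.mem_image]
    constructor
    · rintro ⟨u, hu, rfl⟩; rwa [hp]
    · intro h; exact ⟨p v, h, hp v⟩
  have hPBR : PB ⊆ R := by
    intro v hv
    rw [mPB, mB, hXp, not_not] at hv
    rw [mR]
    refine ⟨hv.2, fun h => hind v h _ hv.1 (hpa v), fun h => (hDX' v h).2 hv.1⟩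
  have mU : ∀ v, v ∈ U ↔ v ∈ R ∧ v ∉ PB := by intro v; simp [hU]
  have hUL : ∀ v ∈ U, p v ∈ Lam := by
    intro v hv
    rw [mU, mPB, mB, mR, hXp] at hv
    rw [mL, hXp]
    tauto
  have cPB : PB.card = B.card := Finset.card_image_of_injective _ hpinj
  have cU : U.card + B.card = R.card := by
    rw [hU, Finset.card_sdiff_of_subset hPBR, cPB]
    have := Finset.card_le_card hPBR
    omega
  have hX'D : X' ⊆ X \ D := fun x hx => Finset.mem_sdiff.2 ⟨hX' hx, (hDX' x hx).1⟩
  have cXD : (X \ D).card = X'.card + R.card := by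
    rw [hR, Finset.card_sdiff_of_subset hX'D]
    have := Finset.card_le_card hX'D
    omega
  have cD : D.card + (X \ D).card = X.card + B.card := by
    have h1 := Finset.card_sdiff_add_card_inter X D
    have h2 : D = (X ∩ D) ∪ B := by
      ext v; rw [Finset.mem_union, mB, Finset.mem_inter]; tauto
    have h3 : D.card = (X ∩ D).card + B.card := by
      conv_lhs => rw [h2]
      apply Finset.card_union_of_disjoint
      rw [Finset.disjoint_left]
      intro v hv
      rw [mB]; rw [Finset.mem_inter] at hv; tauto
    omega
  suffices hgoal : ∃ e, Exc G (Finset.univ \ D) e ∧ 2 * k ≤ e + U.card + t by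
    obtain ⟨e, he, h⟩ := hgoal
    exact ⟨e, he, by omega⟩
  -- base matching
  have hQ0 : Exc G (U ∪ U.image p) U.card := by
    obtain ⟨f0, hf0, hs0⟩ := exists_isM_of_inj (G := G) Finset.univ U p hpinj.injOn
      (fun v _ => ⟨Finset.mem_univ _, Finset.mem_univ _, hpa v⟩) (by
        rintro v hv u hu rfl
        have := hUL v hv
        rw [mL] at this
        rw [mU, mR] at hu
        exact this.2 hu.1.1)
    obtain ⟨m, hm, he⟩ := hf0.exc
    rw [hs0, card_of_inj hpinj.injOn] at hm
    · rw [hs0] at he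
      exact he.anti (by omega)
    · rintro v hv u hu rfl
      have := hUL v hv
      rw [mL] at this
      rw [mU, mR] at hu
      exact this.2 hu.1.1
  have hQ0D : U ∪ U.image p ⊆ Finset.univ \ D := by
    intro v hv
    rw [Finset.mem_sdiff]
    refine ⟨Finset.mem_univ _, ?_⟩
    rcases Finset.mem_union.1 hv with h | h
    · rw [mU, mR] at h; exact h.1.2.1
    · obtain ⟨u, hu, rfl⟩ := Finset.mem_image.1 h
      exact ((mL _).1 (hUL u hu)).1
  by_cases hdk : k ≤ U.card
  · exact ⟨_, hQ0.mono hQ0D, by omega⟩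
  push Not at hdk
  -- degree splitting
  have hsplit : ∀ v, (N v).card = (N v ∩ X).card + (N v ∩ Y).card := by
    intro v
    rw [← card_inter_add]
    · congr 1; ext u; simp [hY]; tauto
    · rw [Finset.disjoint_left]; intro u hu; rw [hY]; tauto
  have hsplitY : ∀ v, (N v ∩ Y).card = (N v ∩ B).card + (N v ∩ Lam).card := by
    intro v
    rw [← card_inter_add]
    · congr 1; ext u; rw [Finset.mem_inter, Finset.mem_inter, Finset.mem_union, mB, mL, hY]; tauto
    · rw [Finset.disjoint_left]; intro u hu; rw [mL]; rw [mB] at hu; tauto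
  have hNB : ∀ v, (N v ∩ B).card ≤ B.card := fun v => Finset.card_le_card Finset.inter_subset_right
  have hBind : ∀ u ∈ B, ∀ v ∈ B, ¬ G.Adj u v := fun u hu v hv =>
    hind u ((mB u).1 hu).1 v ((mB v).1 hv).1
  have hBY : B ⊆ Y := Finset.inter_subset_right
  -- cross degree of B
  have hcrB : ∀ w ∈ B, (N w ∩ X).card ≤ X'.card + R.card := by
    intro w hw
    rw [← cXD]
    apply Finset.card_le_card
    intro v hv
    rw [Finset.mem_inter, hN] at hv
    exact Finset.mem_sdiff.2 ⟨hv.2, fun h => hind w ((mB w).1 hw).1 v h hv.1⟩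
  have hBdeg : ∀ w ∈ B, B.card ≤ (N w ∩ Y).card := by
    intro w hw
    have := hcrB w hw
    have := hsplit w
    have := hdeg w
    omega
  -- step 2
  have hrm : nu G X ≤ R.card := by
    have h1 := Finset.card_sdiff_add_card_inter (supp f) D
    have h2 : supp f \ D ⊆ R := by
      intro v hv
      rw [Finset.mem_sdiff] at hv
      rw [mR]
      exact ⟨hf.1.supp_sub hv.1, hv.2, fun h => mem_supp.1 hv.1 (hX's v h)⟩
    have h3 : (supp f ∩ D).image f ⊆ supp f \ D := by
      intro v hv
      obtain ⟨u, hu, rfl⟩ := Finset.mem_image.1 hv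
      rw [Finset.mem_inter] at hu
      exact Finset.mem_sdiff.2 ⟨hf.1.map_supp hu.1, fun h =>
        hind u hu.2 _ h (hf.1.2 u (mem_supp.1 hu.1)).2⟩
    have h2 := Finset.card_le_card h2
    have h3 := Finset.card_le_card h3
    rw [Finset.card_image_of_injective _ hf.1.inj] at h3
    have := hf.2
    omega
  -- step 3
  have hbY : B.card ≤ nu G Y := by
    obtain ⟨f2, hf2, hc2⟩ := cov (G := G) Y B N hN hBY hBind hBdeg
    have := card_indep_cov hf2.1 hc2 hBind
    have := hf2.2
    omega
  -- step 4
  set Bad := PB.filter fun z => (N z ∩ Lam).card < R.card with hBad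
  set Good := PB.filter fun z => ¬ (N z ∩ Lam).card < R.card with hGood
  have cGB : Bad.card + Good.card = B.card := by
    rw [← cPB]; exact Finset.card_filter_add_card_filter_not _
  have hBadPB : Bad ⊆ PB := Finset.filter_subset _ _
  have hGoodPB : Good ⊆ PB := Finset.filter_subset _ _
  have hBadX : ∀ z ∈ Bad, z ∈ X := fun z hz => ((mR z).1 (hPBR (hBadPB hz))).1
  have hcrZ : ∀ z ∈ Bad, (N z ∩ Y).card + 1 ≤ B.card + R.card := by
    intro z hz
    have h1 := (Finset.mem_filter.1 hz).2
    have := hsplitY z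
    have := hNB z
    omega
  have hbad : ∀ z ∈ Bad, 2 * nu G X + 2 ≤ (N z ∩ X).card := by
    intro z hz
    have := hcrZ z hz
    have := hsplit z
    have := hdeg z
    omega
  have hBs : ∀ z ∈ Bad, z ∈ supp f ∧ (∃ y ∈ X, f y = y ∧ G.Adj z y) ∧
      ∀ x ∈ X, f x = x → ¬ G.Adj x (f z) := fun z hz => bad_struct hN hf (hBadX z hz) (hbad z hz)
  have hBadf : ∀ z ∈ Bad, f z ∉ Bad := by
    intro z hz hfz
    obtain ⟨_, ⟨y, hy, hfy, hadj⟩, _⟩ := hBs _ hfz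
    exact (hBs z hz).2.2 y hy hfy hadj.symm
  have hdelta : Bad.card ≤ nu G X := by
    have h1 := card_supp_half hf.1 (K := Bad) (fun z hz => (hBs z hz).1)
    have h2 : (Bad.filter fun v => f v ∈ Bad) = ∅ := by
      rw [Finset.filter_eq_empty_iff]
      exact fun v hv => hBadf v hv
    rw [h2, hf.2] at h1
    simp at h1
    omega
  by_cases hmain : t ≤ 2 * U.card + Good.card
  · -- step 5
    set tau : V → Finset V := fun x => (supp f).filter fun v => G.Adj x v ∧ G.Adj x (f v) with htau
    have hT : ∀ x ∈ X', (N x ∩ (X \ Bad)).card + Bad.card ≤ nu G X + (tau x).card / 2 := by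
      intro x hx
      have hxX := hX' hx
      have hfx := hX's x hx
      have hsub : N x ∩ (X \ Bad) ∪ Bad ⊆ supp f := by
        intro v hv
        rcases Finset.mem_union.1 hv with h | h
        · apply hf.nbr_sub hN hxX hfx
          rw [Finset.mem_inter, Finset.mem_sdiff] at h
          rw [Finset.mem_inter]; tauto
        · exact (hBs v h).1
      have h1 := card_supp_half hf.1 hsub
      have h2 : ((N x ∩ (X \ Bad) ∪ Bad).filter fun v => f v ∈ N x ∩ (X \ Bad) ∪ Bad) ⊆ tau x := by
        intro v hv
        rw [Finset.mem_filter] at hv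
        obtain ⟨hv1, hv2⟩ := hv
        rw [htau, Finset.mem_filter]
        refine ⟨hsub hv1, ?_⟩
        have hvs := hsub hv1
        rw [Finset.mem_union, Finset.mem_inter, hN] at hv1 hv2
        rcases hv1 with h3 | h3
        · rcases hv2 with h4 | h4
          · exact ⟨h3.1, h4.1⟩
          · exfalso
            have := (hBs _ h4).2.2 x hxX hfx
            rw [hf.1.1] at this
            exact this h3.1
        · rcases hv2 with h4 | h4
          · exact absurd h4.1 ((hBs _ h3).2.2 x hxX hfx)
          · exact absurd h4 (hBadf v h3)
      have h3 := Finset.card_le_card h2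
      rw [hf.2, Finset.card_union_of_disjoint] at h1
      · omega
      · rw [Finset.disjoint_left]
        intro v hv
        rw [Finset.mem_inter, Finset.mem_sdiff] at hv
        exact hv.2.2
    have hsum : ∑ x ∈ X', (tau x).card / 2 ≤ nu G X := by
      have h1 : ∑ x ∈ X', (tau x).card = (X'.biUnion tau).card := by
        rw [Finset.card_biUnion]
        intro x hx y hy hxy
        rw [Function.onFun, Finset.disjoint_left]
        intro v hv hv'
        rw [htau, Finset.mem_filter] at hv hv'
        exact hf.no_aug (hX' hx) (hX' hy) (hX's x hx) (hX's y hy) hxy (mem_supp.1 hv.1)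
          hv.2.2 hv'.2.1
      have h2 : (X'.biUnion tau).card ≤ (supp f).card := by
        apply Finset.card_le_card
        rw [Finset.biUnion_subset]
        intro x _
        exact Finset.filter_subset _ _
      have h3 : 2 * ∑ x ∈ X', (tau x).card / 2 ≤ ∑ x ∈ X', (tau x).card := by
        rw [Finset.mul_sum]
        apply Finset.sum_le_sum
        intro x _
        omega
      have := hf.2
      omega
    -- the choice of parameters
    obtain ⟨g', i, hg', hi, hroom, htarget⟩ : ∃ g' i, g' ≤ Good.card ∧ i ≤ X'.card ∧
        U.card + g' + X'.card + 2 * i + B.card + nu G X ≤ 3 * k + Bad.card ∧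
        2 * k ≤ U.card + g' + X'.card + i + U.card + t := by
      by_cases h1 : 2 * U.card + Good.card ≤ k
      · refine ⟨Good.card, k - 2 * U.card - Good.card, le_refl _, by omega, ?_, by omega⟩
        rcases ht3 with h | h <;> omega
      · by_cases h2 : 2 * U.card ≤ k
        · refine ⟨k - 2 * U.card, 0, by omega, by omega, ?_, by omega⟩
          omega
        · refine ⟨0, 0, by omega, by omega, ?_, by omega⟩
          omega
    obtain ⟨C, hC, hCc⟩ := Finset.exists_subset_card_eq hg'
    have hCPB := hC.trans hGoodPB
    have hCX : ∀ v ∈ C, v ∈ X ∧ v ∉ D ∧ v ∉ X' := fun v hv => (mR v).1 (hPBR (hCPB hv))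
    have hQ0L : ((U ∪ U.image p) ∩ Lam).card = U.card := by
      have : (U ∪ U.image p) ∩ Lam = U.image p := by
        ext v
        rw [Finset.mem_inter, Finset.mem_union]
        constructor
        · rintro ⟨h | h, h'⟩
          · rw [mL] at h'
            rw [mU, mR] at h
            exact absurd h.1.1 h'.2
          · exact h
        · intro h
          refine ⟨Or.inr h, ?_⟩
          obtain ⟨u, hu, rfl⟩ := Finset.mem_image.1 h
          exact hUL u hu
      rw [this, Finset.card_image_of_injective _ hpinj]
    obtain ⟨Q1, q1, q2, q3⟩ := star_lemma N hN Lam (fun _ => 0) C.card C (U ∪ U.image p)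
      U.card 0 rfl hQ0 (by
        rw [Finset.disjoint_left]
        intro v hv hvC
        rcases Finset.mem_union.1 hv with h | h
        · exact ((mU v).1 h).2 (hCPB hvC)
        · obtain ⟨u, hu, rfl⟩ := Finset.mem_image.1 h
          exact ((mL _).1 (hUL u hu)).2 (hCX _ hvC).1) (by
        rw [Finset.disjoint_left]
        intro v hv hvL
        exact ((mL _).1 hvL).2 (hCX v hv).1) (by
        rcases C.eq_empty_or_nonempty with h | h
        · exact Or.inl h
        · right; simpa using h) (by omega) (by
        intro x hx
        have h1 := (Finset.mem_filter.1 (hC hx)).2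
        rw [hQ0L]
        omega)
    have hQ1m : ∀ v ∈ Q1, v ∈ Lam ∨ (v ∈ X ∧ v ∉ D ∧ v ∉ X' ∧ v ∉ Bad) := by
      intro v hv
      have := q1 hv
      rcases Finset.mem_union.1 this with h | h
      · rcases Finset.mem_union.1 h with h | h
        · rcases Finset.mem_union.1 h with h | h
          · right
            rw [mU, mR] at h
            exact ⟨h.1.1, h.1.2.1, h.1.2.2, fun h' => h.2 (hBadPB h')⟩
          · left
            obtain ⟨u, hu, rfl⟩ := Finset.mem_image.1 h
            exact hUL u hu
        · right
          obtain ⟨a1, a2, a3⟩ := hCX v h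
          exact ⟨a1, a2, a3, fun h' =>
            (Finset.mem_filter.1 (hC h)).2 (Finset.mem_filter.1 h').2⟩
      · exact Or.inl h
    have hQ1L : (Q1 ∩ (Lam ∪ Bad)).card = U.card + C.card := by
      have : Q1 ∩ (Lam ∪ Bad) = Q1 ∩ Lam := by
        ext v
        simp only [Finset.mem_inter, Finset.mem_union]
        constructor
        · rintro ⟨h1, h2 | h2⟩
          · exact ⟨h1, h2⟩
          · rcases hQ1m v h1 with h | h
            · exact ⟨h1, h⟩
            · exact absurd h2 h.2.2.2
        · rintro ⟨h1, h2⟩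
          exact ⟨h1, Or.inl h2⟩
      rw [this, q2, hQ0L]
      omega
    have hdLB : Disjoint Lam Bad := by
      rw [Finset.disjoint_left]
      intro v hv hvB
      exact ((mL v).1 hv).2 (hBadX v hvB)
    obtain ⟨Q2, s1, s2, s3⟩ := star_lemma N hN (Lam ∪ Bad) (fun x => (tau x).card / 2) X'.card X'
      Q1 _ i rfl q3 (by
        rw [Finset.disjoint_left]
        intro v hv hvX
        rcases hQ1m v hv with h | h
        · exact ((mL v).1 h).2 (hX' hvX)
        · exact h.2.2.1 hvX) (by
        rw [Finset.disjoint_left]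
        intro v hv hvX
        rcases Finset.mem_union.1 hvX with h | h
        · exact ((mL v).1 h).2 (hX' hv)
        · exact ((mR v).1 (hPBR (hBadPB h))).2.2 hv) (by
        right; omega) hi (by
        intro x hx
        rw [hQ1L, card_inter_add hdLB]
        have h1 := hT x hx
        have h2 := hsplit x
        have h3 := hsplitY x
        have h4 := hNB x
        have h5 := hdeg x
        have h6 : (N x ∩ X).card = (N x ∩ (X \ Bad)).card + (N x ∩ Bad).card := by
          rw [← card_inter_add Finset.sdiff_disjoint, Finset.sdiff_union_of_subset]
          exact hBadX
        omega)
    refine ⟨_, s3.mono ?_, by omega⟩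
    intro v hv
    rw [Finset.mem_sdiff]
    refine ⟨Finset.mem_univ _, ?_⟩
    have := s1 hv
    simp only [Finset.mem_union] at this
    rcases this with (h | h) | h | h
    · rcases hQ1m v h with h | h
      · exact ((mL v).1 h).1
      · exact h.2.1
    · exact (hDX' v h).1
    · exact ((mL v).1 h).1
    · exact ((mR v).1 (hPBR (hBadPB h))).2.1
  · -- step 8
    exfalso
    push Not at hmain
    have hpos : 0 < Bad.card := by omega
    obtain ⟨z, hz⟩ := Finset.card_pos.1 hpos
    have hw : p z ∈ B := (mPB z).1 (hBadPB hz)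
    have n1 := nu_erase_lt hN (hBadX z hz) (by have := hbad z hz; omega)
    have c1 := hcrB _ hw
    have c2 := hsplit (p z)
    have c3 := hdeg (p z)
    have n2 := nu_erase_lt' hN hBY hBind hw hBdeg (by omega)
    have h1 := hflip z (hBadX z hz) (by omega)
    have c4 := hcrZ z hz
    have c5 := hsplit z
    have c6 := hdeg z
    omega

lemma sum_inter_insert {N : V → Finset V} (hN : ∀ v u, u ∈ N v ↔ G.Adj v u) (A C : Finset V)
    {x : V} (hx : x ∉ C) :
    ∑ v ∈ A, (N v ∩ insert x C).card = ∑ v ∈ A, (N v ∩ C).card + (N x ∩ A).card := by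
  have h1 : ∀ v ∈ A, (N v ∩ insert x C).card = (N v ∩ C).card + if v ∈ N x then 1 else 0 := by
    intro v _
    by_cases h : v ∈ N x
    · have h' : x ∈ N v := by rw [hN] at *; exact h.symm
      rw [Finset.inter_insert_of_mem h', Finset.card_insert_of_notMem (by simp [hx]), if_pos h]
    · have h' : x ∉ N v := by rw [hN] at *; exact fun h2 => h h2.symm
      rw [Finset.inter_insert_of_notMem h', if_neg h, add_zero]
  rw [Finset.sum_congr rfl h1, Finset.sum_add_distrib]
  congr 1
  rw [Finset.sum_ite, Finset.sum_const_zero, add_zero, Finset.sum_const, smul_eq_mul, mul_one]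
  congr 1
  ext v; simp [and_comm]

lemma flip_lemma {N : V → Finset V} (hN : ∀ v u, u ∈ N v ↔ G.Adj v u) (p : V → V)
    (hp : ∀ v, p (p v) = v) (hpa : ∀ v, G.Adj v (p v)) (k : ℕ) (X : Finset V)
    (hXp : ∀ v, p v ∈ X ↔ v ∉ X) (hm : nu G X + nu G Xᶜ + 1 ≤ k)
    (hmax : ∀ X2 : Finset V, (∀ v, p v ∈ X2 ↔ v ∉ X2) → nu G X2 + nu G X2ᶜ + 1 ≤ k →
      ∑ v ∈ X2, (N v ∩ X2ᶜ).card ≤ ∑ v ∈ X, (N v ∩ Xᶜ).card) (z : V) (hz : z ∈ X)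
    (hnu : nu G (X.erase z) + nu G (Xᶜ.erase (p z)) + 2 ≤ nu G X + nu G Xᶜ) :
    (N z ∩ X).card + (N (p z) ∩ Xᶜ).card + 2 ≤ (N z ∩ Xᶜ).card + (N (p z) ∩ X).card := by
  set w := p z with hw
  have hzw : G.Adj z w := hpa z
  have hwX : w ∉ X := by rw [hw, hXp, not_not]; exact hz
  have hne := hzw.ne
  set A := X.erase z with hA
  set C := Xᶜ.erase w with hC
  have hXA : X = insert z A := (Finset.insert_erase hz).symm
  have hXC : Xᶜ = insert w C := (Finset.insert_erase (by simpa using hwX)).symm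
  have hzA : z ∉ A := by simp [hA]
  have hwA : w ∉ A := by simp [hA, hwX]
  have hwC : w ∉ C := by simp [hC]
  have hzC : z ∉ C := by simp [hC, hz]
  have hcompl : (insert w A)ᶜ = insert z C := by
    ext v
    simp only [hA, hC, Finset.mem_compl, Finset.mem_insert, Finset.mem_erase]
    by_cases h1 : v = z
    · subst h1; simp [hne]
    · by_cases h2 : v = w
      · subst h2; simp [h1]
      · simp [h1, h2]
  have h1 := hmax (insert w A) (by
    intro v
    simp only [hA, Finset.mem_insert, Finset.mem_erase]
    by_cases h1 : v = z
    · subst h1; simp [hw.symm, hne]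
    · by_cases h2 : v = w
      · subst h2; simp [hw, hp]; simpa [hw] using hne
      · have h3 : p v ≠ z := fun h => h2 (by rw [hw, ← h, hp])
        have h4 : p v ≠ w := fun h => h1 (by rw [← hp v, h, hw, hp])
        simp [h1, h2, h3, h4, hXp]) (by
    have := nu_insert_le (G := G) A w
    have := nu_insert_le (G := G) C z
    rw [hcompl]
    omega)
  rw [hcompl] at h1
  rw [Finset.sum_insert hwA, sum_inter_insert hN A C hzC] at h1
  have h2 : ∑ v ∈ X, (N v ∩ Xᶜ).card =
      (N z ∩ Xᶜ).card + (∑ v ∈ A, (N v ∩ C).card + (N w ∩ A).card) := by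
    conv_lhs => rw [hXC, hXA]
    rw [Finset.sum_insert hzA, sum_inter_insert hN A C hwC, hXC]
  have h3 : (N w ∩ insert z C).card = (N w ∩ C).card + 1 := by
    rw [Finset.inter_insert_of_mem ((hN _ _).2 hzw.symm),
      Finset.card_insert_of_notMem (by simp [hzC])]
  have h4 : (N w ∩ X).card = (N w ∩ A).card + 1 := by
    rw [hXA, Finset.inter_insert_of_mem ((hN _ _).2 hzw.symm),
      Finset.card_insert_of_notMem (by simp [hzA])]
  have h5 : (N z ∩ X).card = (N z ∩ A).card := by
    rw [hXA, Finset.inter_insert_of_notMem]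
    rw [hN]; exact fun h => h.ne rfl
  have h6 : (N w ∩ Xᶜ).card = (N w ∩ C).card := by
    rw [hXC, Finset.inter_insert_of_notMem]
    rw [hN]; exact fun h => h.ne rfl
  omega

lemma min_degree {N : V → Finset V} (hN : ∀ v u, u ∈ N v ↔ G.Adj v u) (k : ℕ)
    (hconn : G.MConnected (3 * k)) (v : V) : 3 * k ≤ (N v).card := by
  by_contra hcon
  push Not at hcon
  have hc := hconn.2 (N v) hcon
  have hvN : v ∉ N v := by rw [hN]; exact fun h => h.ne rfl
  have h1 : (insert v (N v)).card < Fintype.card V := by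
    rw [Finset.card_insert_of_notMem hvN]
    have := hconn.1
    omega
  obtain ⟨u, hu⟩ : ∃ u, u ∉ insert v (N v) := by
    by_contra h
    push Not at h
    rw [Finset.eq_univ_iff_forall.2 h, Finset.card_univ] at h1
    omega
  rw [Finset.mem_insert, not_or] at hu
  refine hu.1 (conn_closed hc (fun x => x = v) ?_ (a := v) (b := u) (by simp [hvN])
    (by simp [hu.2]) rfl)
  rintro a ha b hb hab rfl
  simp only [Finset.coe_sdiff, Finset.coe_univ, Set.mem_sdiff, Set.mem_univ, true_and,
      Finset.mem_coe, hN] at hb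
  exact absurd hab hb

lemma transversal_card (p : V → V) (hp : ∀ v, p (p v) = v) (X : Finset V)
    (hXp : ∀ v, p v ∈ X ↔ v ∉ X) : X.card = Xᶜ.card := by
  have hpinj : Function.Injective p := fun a b h => by rw [← hp a, ← hp b, h]
  have : Xᶜ = X.image p := by
    ext v
    rw [Finset.mem_compl, Finset.mem_image, ← hXp]
    constructor
    · intro h; exact ⟨p v, h, hp v⟩
    · rintro ⟨u, hu, rfl⟩; rwa [hp]
  rw [this, Finset.card_image_of_injective _ hpinj]

lemma exists_transversal (p : V → V) (hp : ∀ v, p (p v) = v) (hpa : ∀ v, G.Adj v (p v))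
    (D : Finset V) (hind : ∀ u ∈ D, ∀ v ∈ D, ¬ G.Adj u v) :
    ∃ X : Finset V, D ⊆ X ∧ ∀ v, p v ∈ X ↔ v ∉ X := by
  classical
  obtain ⟨X, hX, hmax⟩ := Finset.exists_max_image
    (Finset.univ.filter fun X : Finset V => D ⊆ X ∧ ∀ v ∈ X, p v ∉ X) Finset.card
    ⟨D, by
      simp only [Finset.mem_filter, Finset.mem_univ, true_and]
      exact ⟨le_refl _, fun v hv h => hind v hv _ h (hpa v)⟩⟩
  simp only [Finset.mem_filter, Finset.mem_univ, true_and] at hX hmax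
  refine ⟨X, hX.1, fun v => ⟨fun h h' => hX.2 v h' h, fun h => ?_⟩⟩
  by_contra h2
  have := hmax (insert v X) ⟨hX.1.trans (Finset.subset_insert _ _), by
    intro u hu hpu
    rw [Finset.mem_insert] at hu hpu
    rcases hu with rfl | hu
    · rcases hpu with h3 | h3
      · exact (hpa u).ne h3.symm
      · exact h2 h3
    · rcases hpu with h3 | h3
      · apply h2; rw [← h3, hp]; exact hu
      · exact hX.2 u hu h3⟩
  rw [Finset.card_insert_of_notMem h] at this
  omega

lemma main_win (k : ℕ) (hk : 1 ≤ k) (hconn : G.MConnected (3 * k)) (p : V → V)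
    (hp : ∀ v, p (p v) = v) (hpa : ∀ v, G.Adj v (p v)) (h : ℕ) (hh : Fintype.card V = 2 * h)
    (hhk : 2 * k ≤ h) : Win G Finset.univ (3 * h + k) := by
  classical
  by_contra hcon
  set N : V → Finset V := fun v => Finset.univ.filter fun u => G.Adj v u with hNdef
  have hN : ∀ v u, u ∈ N v ↔ G.Adj v u := by intro v u; simp [hNdef]
  have hpinj : Function.Injective p := fun a b h => by rw [← hp a, ← hp b, h]
  have hdeg := min_degree hN k hconn
  have hcardX : ∀ X : Finset V, (∀ v, p v ∈ X ↔ v ∉ X) → X.card = h ∧ Xᶜ.card = h := by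
    intro X hX
    have h1 := transversal_card p hp X hX
    have h2 := Finset.card_add_card_compl X
    omega
  -- step 1
  obtain ⟨X0, hX0p, hX0⟩ : ∃ X : Finset V, (∀ v, p v ∈ X ↔ v ∉ X) ∧
      nu G X + nu G Xᶜ + 1 ≤ k := by
    have h1 : ∃ D, G.MaxIndepSubset Finset.univ D ∧
        ¬ Win G (Finset.univ \ D) (3 * h + k - (Finset.univ : Finset V).card) := by
      by_contra h2
      push Not at h2
      refine hcon (Win.step _ Finset.univ _ (le_refl _) ?_ h2)
      rw [← Finset.card_pos, Finset.card_univ]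
      omega
    obtain ⟨D, hD, hDw⟩ := h1
    rw [Finset.card_univ, hh] at hDw
    obtain ⟨X, hDX, hXp⟩ := exists_transversal (G := G) p hp hpa D hD.2.1
    refine ⟨X, hXp, ?_⟩
    obtain ⟨f, hf, hfc⟩ := exists_nu G X
    have c0 := (hcardX X hXp).1
    have c1 := Finset.card_sdiff_add_card_inter (supp f) D
    have c2 : supp f \ D ⊆ X \ D := Finset.sdiff_subset_sdiff hf.supp_sub (le_refl _)
    have c3 : (supp f ∩ D).image f ⊆ X \ D := by
      intro v hv
      obtain ⟨u, hu, rfl⟩ := Finset.mem_image.1 hv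
      rw [Finset.mem_inter] at hu
      exact Finset.mem_sdiff.2 ⟨hf.supp_sub (hf.map_supp hu.1), fun h =>
        hD.2.1 u hu.2 _ h (hf.2 u (mem_supp.1 hu.1)).2⟩
    have c2 := Finset.card_le_card c2
    have c3 := Finset.card_le_card c3
    have c4 := Finset.card_le_card hDX
    rw [Finset.card_image_of_injective _ hf.inj] at c3
    rw [Finset.card_sdiff_of_subset hDX] at c2 c3
    have c5 : Exc G (Finset.univ \ D) (nu G Xᶜ) := (exc_nu G Xᶜ).mono (by
      intro v hv
      rw [Finset.mem_compl] at hv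
      exact Finset.mem_sdiff.2 ⟨Finset.mem_univ _, fun h => hv (hDX h)⟩)
    unfold Exc at c5
    rw [Finset.card_sdiff_of_subset (Finset.subset_univ D), Finset.card_univ, hh] at c5
    by_contra h6
    exact hDw (c5.anti _ (by omega))
  -- step 2
  obtain ⟨X, hX, hXmax⟩ := Finset.exists_max_image
    (Finset.univ.filter fun X : Finset V => (∀ v, p v ∈ X ↔ v ∉ X) ∧ nu G X + nu G Xᶜ + 1 ≤ k)
    (fun X => ∑ v ∈ X, (N v ∩ Xᶜ).card) ⟨X0, by
      simp only [Finset.mem_filter, Finset.mem_univ, true_and]; exact ⟨hX0p, hX0⟩⟩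
  simp only [Finset.mem_filter, Finset.mem_univ, true_and] at hX hXmax
  obtain ⟨hXp, hm⟩ := hX
  have hflip := flip_lemma hN p hp hpa k X hXp hm fun X2 h1 h2 => hXmax X2 ⟨h1, h2⟩
  obtain ⟨cX, cY⟩ := hcardX X hXp
  -- step 3
  obtain ⟨t, ht1, ht2, ht3⟩ : ∃ t, t ≤ nu G X ∧ t ≤ nu G Xᶜ ∧ (t = nu G X ∨ t = nu G Xᶜ) := by
    rcases le_total (nu G X) (nu G Xᶜ) with h1 | h1
    · exact ⟨_, le_refl _, h1, Or.inl rfl⟩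
    · exact ⟨_, h1, le_refl _, Or.inr rfl⟩
  have hsplit : ∀ v, (N v).card = (N v ∩ X).card + (N v ∩ Xᶜ).card := by
    intro v
    rw [← card_inter_add disjoint_compl_right, Finset.union_compl, Finset.inter_univ]
  have hdX : 3 * k - h ≤ nu G X := by
    by_cases h2 : 2 * nu G X + 2 ≤ X.card
    · refine mindeg (G := G) X N hN _ ?_ h2
      intro v _
      have := hdeg v
      have := hsplit v
      have := Finset.card_le_card (Finset.inter_subset_right (s₁ := N v) (s₂ := Xᶜ))
      omega
    · omega
  have hdY : 3 * k - h ≤ nu G Xᶜ := by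
    by_cases h2 : 2 * nu G Xᶜ + 2 ≤ Xᶜ.card
    · refine mindeg (G := G) Xᶜ N hN _ ?_ h2
      intro v _
      have := hdeg v
      have := hsplit v
      have := Finset.card_le_card (Finset.inter_subset_right (s₁ := N v) (s₂ := X))
      omega
    · omega
  obtain ⟨fX, hfX⟩ := exists_nu G X
  obtain ⟨fY, hfY⟩ := exists_nu G Xᶜ
  obtain ⟨X', hX', hX'c⟩ := Finset.exists_subset_card_eq
    (s := (X \ supp fX) \ (supp fY).image p) (n := k - t) (by
      have h1 := Finset.le_card_sdiff ((supp fY).image p) (X \ supp fX)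
      rw [Finset.card_sdiff_of_subset hfX.1.supp_sub, Finset.card_image_of_injective _ hpinj] at h1
      rcases ht3 with h | h <;> omega)
  have hX'm : ∀ x ∈ X', x ∈ X ∧ fX x = x ∧ fY (p x) = p x := by
    intro x hx
    have := hX' hx
    simp only [Finset.mem_sdiff, mem_supp, not_not, Finset.mem_image, not_exists, not_and] at this
    refine ⟨this.1.1, this.1.2, ?_⟩
    by_contra h
    exact this.2 (p x) h (hp x)
  have hX'X : X' ⊆ X := fun x hx => (hX'm x hx).1
  set S := X' ∪ X'.image p with hS
  have cS : S.card = 2 * X'.card := by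
    refine card_of_inj hpinj.injOn ?_
    rintro v hv u hu rfl
    exact ((hXp v).1 (hX'X hu)) (hX'X hv)
  have cM : (Finset.univ \ S).card = 2 * h - 2 * (k - t) := by
    rw [Finset.card_sdiff_of_subset (Finset.subset_univ _), Finset.card_univ, hh, cS, hX'c]
  refine hcon (Win.step _ (Finset.univ \ S) _ (Finset.subset_univ _) ?_ ?_)
  · rw [← Finset.card_pos]; omega
  intro D hD
  rw [cM]
  have hind := hD.2.1
  have hDX' : ∀ x ∈ X', x ∉ D ∧ p x ∉ D := by
    intro x hx
    constructor
    · intro h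
      exact (Finset.mem_sdiff.1 (hD.1 h)).2 (Finset.mem_union_left _ hx)
    · intro h
      exact (Finset.mem_sdiff.1 (hD.1 h)).2
        (Finset.mem_union_right _ (Finset.mem_image_of_mem _ hx))
  have cD : D.card + (k - t) ≤ h := by
    have h1 : D.image (fun v => if v ∈ X then v else p v) ⊆ X \ X' := by
      intro v hv
      obtain ⟨u, hu, rfl⟩ := Finset.mem_image.1 hv
      by_cases huX : u ∈ X
      · simp only [huX, if_true]
        exact Finset.mem_sdiff.2 ⟨huX, fun h => (hDX' u h).1 hu⟩
      · simp only [huX, if_false]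
        refine Finset.mem_sdiff.2 ⟨(hXp u).2 huX, fun h => (hDX' _ h).2 ?_⟩
        rwa [hp]
    have h2 := Finset.card_le_card h1
    rw [Finset.card_image_of_injOn, Finset.card_sdiff_of_subset hX'X] at h2
    · have := Finset.card_le_card hX'X
      omega
    · intro a ha b hb hab
      rw [Finset.mem_coe] at ha hb
      by_cases h3 : a ∈ X <;> by_cases h4 : b ∈ X <;> simp only [h3, h4, if_true, if_false] at hab
      · exact hab
      · exact absurd (hab ▸ hpa b) (hind b hb a ha)
      · exact absurd (hab ▸ hpa a) (hind a ha b hb)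
      · exact hpinj hab
  suffices hgoal : ∃ e, Exc G (Finset.univ \ D) e ∧ 3 * k + D.card ≤ e + h + 2 * t by
    obtain ⟨e, he, hle⟩ := hgoal
    unfold Exc at he
    rw [Finset.card_sdiff_of_subset (Finset.subset_univ D), Finset.card_univ, hh] at he
    refine he.anti _ ?_
    omega
  rcases cut_case (G := G) N hN X D k hconn hind hm with h1 | h1 | h1
  · exact ⟨_, h1, by omega⟩
  · have h2 : (Finset.univ.filter fun v => v ∈ X ↔ v ∈ D) = (D ∩ X) ∪ (Xᶜ \ D) := by
      ext v; simp; tauto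
    rw [h2, Finset.card_union_of_disjoint (by
      rw [Finset.disjoint_left]; intro v; simp; tauto)] at h1
    have := nearX (G := G) hN p hp hpa k hdeg Xᶜ X (by simp) (by
      intro v; rw [Finset.mem_compl, Finset.mem_compl, hXp]) fY hfY (X'.image p) (by
      intro v hv
      obtain ⟨u, hu, rfl⟩ := Finset.mem_image.1 hv
      rw [Finset.mem_compl, hXp, not_not]
      exact hX'X hu) (by
      intro v hv
      obtain ⟨u, hu, rfl⟩ := Finset.mem_image.1 hv
      exact (hX'm u hu).2.2) t (by
      rw [Finset.card_image_of_injective _ hpinj]; omega) (by omega) ht2 ht1 ht3.symm D hind (by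
      intro v hv
      obtain ⟨u, hu, rfl⟩ := Finset.mem_image.1 hv
      rw [hp]
      exact (hDX' u hu).symm) h1 (by
      intro z hz hnu
      have hz' : p z ∈ X := by rw [hXp]; simpa using hz
      have := hflip (p z) hz'
      rw [hp] at this
      have := this (by omega)
      omega)
    rw [cY] at this
    exact this
  · have h2 : (Finset.univ.filter fun v => ¬ (v ∈ X ↔ v ∈ D)) = (D ∩ Xᶜ) ∪ (X \ D) := by
      ext v; simp; tauto
    rw [h2, Finset.card_union_of_disjoint (by
      rw [Finset.disjoint_left]; intro v; simp; tauto)] at h1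
    have := nearX (G := G) hN p hp hpa k hdeg X Xᶜ (by simp) hXp fX hfX X' hX'X
      (fun x hx => (hX'm x hx).2.1) t (by omega) (by omega) ht1 ht2 ht3 D hind hDX' h1 hflip
    rw [cX] at this
    exact this
end SlowC

/-- **Main theorem.** If `k ≥ 1` and `G` is a `3k`-connected graph on `n ≥ 4k`
vertices with a perfect matching, then `2·𝓈(G) ≥ 3n + 2k`. -/
theorem slow_coloring_of_threeK_connected {V : Type*} [Fintype V] [DecidableEq V]
    (G : SimpleGraph V) (k : ℕ) (hk : 1 ≤ k)
    (hconn : G.MConnected (3 * k)) (hn : 4 * k ≤ Fintype.card V)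
    (hpm : ∃ M : G.Subgraph, M.IsPerfectMatching) :
    3 * Fintype.card V + 2 * k ≤ 2 * G.sumColorCost := by
  classical
  obtain ⟨M, hM⟩ := hpm
  have hex : ∀ v, ∃! w, M.Adj v w := fun v => hM.1 (hM.2 v)
  choose p hp hpu using hex
  have hpp : ∀ v, p (p v) = v := fun v => (hpu (p v) v (hp v).symm).symm
  have hpa : ∀ v, G.Adj v (p v) := fun v => (hp v).adj_sub
  obtain ⟨X, _, hX⟩ := SlowC.exists_transversal (G := G) p hpp hpa ∅ (by simp)
  have h1 := SlowC.transversal_card p hpp X hX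
  have h2 := Finset.card_add_card_compl X
  have h3 := SlowC.main_win (G := G) k hk hconn p hpp hpa X.card (by omega) (by omega)
  have h4 := h3.le_slowAux (Fintype.card V) (by rw [Finset.card_univ])
  unfold SimpleGraph.sumColorCost
  omega
end

section
/- Let k ≥ 1 and let G be a 3k-connected finite simple graph with n = |V(G)| ≥ 4k vertices and a perfect matching M. Let D be an independent set of vertices of G containing at most one endpoint of each edge of M, with |D| = 2t for some t ≤ k. Then 2·𝓈(G − D) ≥ 3n − 6t (i.e., 𝓈(G − D) ≥ 3n/2 − 3t). -/
/-! Definitions for the slow coloring game (sum-color cost), paintability,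
connectivity and auxiliary graphs. -/

variable {V : Type*}

namespace SlowAux

open Finset
set_option linter.unusedSectionVars false

theorem even_card_invol {α : Type*} (s : Finset α) (g : α → α)
    (hm : ∀ a ∈ s, g a ∈ s) (hne : ∀ a ∈ s, g a ≠ a) (hi : ∀ a ∈ s, g (g a) = a) :
    Even s.card := by
  have h : ∑ x ∈ s, (1 : ZMod 2) = 0 :=
    Finset.sum_involution (fun a _ => g a) (fun _ _ => by decide)
      (fun a ha _ => hne a ha) hm hi
  simp only [Finset.sum_const, nsmul_eq_mul, mul_one] at h
  exact (ZMod.natCast_eq_zero_iff_even).1 h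

theorem acyclic_low {W : Type*} [Fintype W] [Nonempty W] (F : SimpleGraph W)
    (hF : F.IsAcyclic) : ∃ u, ∀ a b, F.Adj u a → F.Adj u b → a = b := by
  obtain ⟨u, v, p, hp, hmax⟩ := SimpleGraph.Walk.exists_isPath_forall_isPath_length_le_length F
  refine ⟨u, ?_⟩
  have key : ∀ w, F.Adj u w → w = p.snd := by
    intro w hw
    apply hF.eq_snd_of_adj_start hp hw
    by_contra hns
    have := hmax _ _ (SimpleGraph.Walk.cons hw.symm p)
      ((SimpleGraph.Walk.cons_isPath_iff _ _).2 ⟨hp, hns⟩)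
    simp at this
  intro a b ha hb
  rw [key a ha, key b hb]

section
variable {W : Type*} [DecidableEq W]

open Classical in
/-- degree of `v` inside `A` -/
noncomputable def dg (F : SimpleGraph W) (A : Finset W) (v : W) : ℕ := (A.filter (F.Adj v)).card

open Classical in
/-- number of even-degree vertices in `A` -/
noncomputable def ev (F : SimpleGraph W) (A : Finset W) : ℕ :=
  (A.filter (fun v => Even (dg F A v))).card

theorem exists_maxIndep (G : SimpleGraph W) (M : Finset W) : ∃ D, G.MaxIndepSubset M D := by
  classical
  obtain ⟨D, hD⟩ := (M.powerset.filter
    (fun D => ∀ u ∈ D, ∀ v ∈ D, ¬ G.Adj u v)).exists_maximal ⟨∅, by simp⟩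
  have h1 := hD.prop
  simp only [mem_filter, mem_powerset] at h1
  refine ⟨D, h1.1, h1.2, ?_⟩
  intro v hv hvD
  by_contra hcon
  push Not at hcon
  have : insert v D ≤ D := by
    apply hD.le_of_ge
    · simp only [mem_filter, mem_powerset]
      refine ⟨insert_subset hv h1.1, ?_⟩
      intro a ha b hb hab
      rw [mem_insert] at ha hb
      rcases ha with rfl | ha <;> rcases hb with rfl | hb
      · exact G.irrefl hab
      · exact hcon b hb hab.symm
      · exact hcon a ha hab
      · exact h1.2 a ha b hb hab
    · exact subset_insert _ _
  exact hvD (this (mem_insert_self _ _))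

theorem slow_step (G : SimpleGraph W) (fuel c : ℕ) (A M : Finset W) (hMA : M ⊆ A)
    (hM : M.Nonempty)
    (h : ∀ D, G.MaxIndepSubset M D → D.Nonempty →
      c ≤ 2 * M.card + 2 * G.slowAux fuel (A \ D)) :
    c ≤ 2 * G.slowAux (fuel + 1) A := by
  classical
  have hle : M.card + sInf {m | ∃ D : Finset W, G.MaxIndepSubset M D ∧
      m = G.slowAux fuel (A \ D)} ≤ G.slowAux (fuel + 1) A := by
    rw [SimpleGraph.slowAux]
    exact Finset.le_sup (f := fun M : Finset W => M.card + sInf {m | ∃ D : Finset W,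
      G.MaxIndepSubset M D ∧ m = G.slowAux fuel (A \ D)})
      (by simp only [mem_filter, mem_powerset]; exact ⟨hMA, hM⟩)
  obtain ⟨D, hD, hm⟩ := Nat.sInf_mem (s := {m | ∃ D : Finset W, G.MaxIndepSubset M D ∧
      m = G.slowAux fuel (A \ D)}) (by
        obtain ⟨D, hD⟩ := exists_maxIndep G M
        exact ⟨_, D, hD, rfl⟩)
  rw [hm] at hle
  have hne : D.Nonempty := by
    obtain ⟨v, hv⟩ := hM
    by_cases hvD : v ∈ D
    · exact ⟨v, hvD⟩
    · obtain ⟨u, hu, _⟩ := hD.2.2 v hv hvD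
      exact ⟨u, hu⟩
  have := h D hD hne
  omega

theorem dg_mono (F : SimpleGraph W) {A B : Finset W} (h : B ⊆ A) (v : W) :
    dg F B v ≤ dg F A v := by
  classical
  exact card_le_card (filter_subset_filter _ h)

theorem dg_eq (F : SimpleGraph W) {A D : Finset W} (v : W)
    (h : ∀ x ∈ D, ¬ F.Adj v x) : dg F (A \ D) v = dg F A v := by
  classical
  unfold dg
  congr 1
  ext x
  simp only [mem_filter, mem_sdiff]
  grind

theorem ev_erase (F : SimpleGraph W) (A : Finset W) (x : W) (hx : x ∈ A) :
    ev F (A \ {x}) + (if Even (dg F A x) then 1 else 0) ≤ ev F A + dg F A x := by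
  classical
  have h1 : (A \ {x}).filter (fun v => Even (dg F (A \ {x}) v)) ⊆
      ((A.filter (fun v => Even (dg F A v))) \ {x}) ∪ A.filter (F.Adj x) := by
    intro v hv
    simp only [mem_filter, mem_sdiff, mem_singleton, mem_union] at hv ⊢
    by_cases hxv : F.Adj x v
    · right; exact ⟨hv.1.1, hxv⟩
    · left
      refine ⟨⟨hv.1.1, ?_⟩, hv.1.2⟩
      rw [← dg_eq F (D := {x}) v]
      · exact hv.2
      · intro y hy; rw [mem_singleton] at hy; subst hy; exact fun h => hxv h.symm
  have h2 := (card_le_card h1).trans (card_union_le _ _)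
  have h3 : ((A.filter (fun v => Even (dg F A v))) \ {x}).card +
      (if Even (dg F A x) then 1 else 0) ≤ (A.filter (fun v => Even (dg F A v))).card := by
    split_ifs with he
    · have hmem : x ∈ A.filter (fun v => Even (dg F A v)) := by simp [hx, he]
      rw [sdiff_singleton_eq_erase, card_erase_of_mem hmem]
      have := card_pos.2 ⟨x, hmem⟩
      omega
    · simpa using card_le_card sdiff_subset
  unfold ev
  have : dg F A x = (A.filter (F.Adj x)).card := rfl
  omega

theorem exists_struct (F : SimpleGraph W) (hF : F.IsAcyclic) (A : Finset W) (hA : A.Nonempty)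
    (h3 : ∀ v ∈ A, dg F A v ≤ 3) (h0 : ∀ v ∈ A, dg F A v ≠ 0) :
    ∃ u ∈ A, ∃ a ∈ A, F.Adj u a ∧ dg F A a = 1 ∧
      (dg F A u ≤ 2 ∨ (∃ b ∈ A, b ≠ a ∧ F.Adj u b ∧ dg F A b = 1)) := by
  classical
  by_cases hB : (A.filter (fun v => dg F A v ≠ 1)).Nonempty
  · set B := A.filter (fun v => dg F A v ≠ 1) with hBdef
    have : Nonempty (B : Set W) := by
      obtain ⟨x, hx⟩ := hB
      exact ⟨⟨x, hx⟩⟩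
    obtain ⟨⟨u, hu⟩, hu'⟩ := acyclic_low (F.induce (B : Set W)) (hF.induce _)
    have huB : u ∈ B := hu
    have huA : u ∈ A := (mem_filter.1 huB).1
    have hu1 := (mem_filter.1 huB).2
    have hle1 : ((A.filter (F.Adj u)).filter (fun v => dg F A v ≠ 1)).card ≤ 1 := by
      rw [card_le_one]
      intro a ha b hb
      simp only [mem_filter] at ha hb
      have := hu' ⟨a, by simp [hBdef, ha]⟩ ⟨b, by simp [hBdef, hb]⟩ (by simpa using ha.1.2)
        (by simpa using hb.1.2)
      exact congrArg Subtype.val this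
    have hsplit := card_filter_add_card_filter_not (s := A.filter (F.Adj u))
      (fun v => dg F A v ≠ 1)
    have hdu : dg F A u = (A.filter (F.Adj u)).card := rfl
    have h0u := h0 u huA
    have h3u := h3 u huA
    set L := (A.filter (F.Adj u)).filter (fun v => ¬ dg F A v ≠ 1) with hL
    have hmem : ∀ a ∈ L, a ∈ A ∧ F.Adj u a ∧ dg F A a = 1 := by
      intro a ha
      simp only [hL, mem_filter, not_not] at ha
      tauto
    by_cases h2 : dg F A u ≤ 2
    · obtain ⟨a, ha⟩ : L.Nonempty := card_pos.1 (by omega)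
      obtain ⟨h1, h2', h3'⟩ := hmem a ha
      exact ⟨u, huA, a, h1, h2', h3', Or.inl h2⟩
    · obtain ⟨a, ha, b, hb, hab⟩ := one_lt_card.1 (show 1 < L.card by omega)
      obtain ⟨h1, h2', h3'⟩ := hmem a ha
      obtain ⟨k1, k2', k3'⟩ := hmem b hb
      exact ⟨u, huA, a, h1, h2', h3', Or.inr ⟨b, k1, hab.symm, k2', k3'⟩⟩
  · have hall : ∀ v ∈ A, dg F A v = 1 := by
      intro v hv
      by_contra hne
      exact hB ⟨v, by simp [hv, hne]⟩
    obtain ⟨u, hu⟩ := hA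
    have : (A.filter (F.Adj u)).Nonempty := card_pos.1 (by
      have := h0 u hu
      unfold dg at this
      omega)
    obtain ⟨a, ha⟩ := this
    rw [mem_filter] at ha
    exact ⟨u, hu, a, ha.1, ha.2, hall a ha.1, Or.inl (by rw [hall u hu]; norm_num)⟩

theorem leaf_unique (F : SimpleGraph W) (A : Finset W) {a u v : W} (h1 : dg F A a = 1)
    (hu : u ∈ A) (hv : v ∈ A) (hau : F.Adj u a) (hav : F.Adj v a) : v = u := by
  classical
  have : (A.filter (F.Adj a)).card ≤ 1 := h1.le
  rw [card_le_one] at this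
  exact this v (by simp [hv, hav.symm]) u (by simp [hu, hau.symm])

theorem potential (G F : SimpleGraph W) (hFG : F ≤ G) (hF : F.IsAcyclic) (fuel : ℕ) :
    ∀ A : Finset W, A.card ≤ fuel → (∀ v ∈ A, dg F A v ≤ 3) →
      3 * A.card ≤ 2 * G.slowAux fuel A + ev F A := by
  classical
  induction fuel with
  | zero =>
    intro A hA _
    have : A.card = 0 := by omega
    omega
  | succ fuel ih =>
    intro A hA h3
    rcases A.eq_empty_or_nonempty with rfl | hne
    · simp
    have ih' : ∀ D ⊆ A, D.Nonempty →
        3 * A.card ≤ 2 * G.slowAux fuel (A \ D) + ev F (A \ D) + 3 * D.card := by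
      intro D hDA hD
      have hc := card_sdiff_add_card_eq_card hDA
      have hp := card_pos.2 hD
      have := ih (A \ D) (by omega) (fun v hv =>
        (dg_mono F sdiff_subset v).trans (h3 v (mem_sdiff.1 hv).1))
      omega
    have hone : ∀ x ∈ A, 3 * A.card + (if Even (dg F A x) then 1 else 0) ≤
        2 * G.slowAux fuel (A \ {x}) + ev F A + dg F A x + 3 := by
      intro x hx
      have := ih' {x} (by simpa using hx) (by simp)
      have h2 := ev_erase F A x hx
      rw [card_singleton] at this
      omega
    suffices hs : 3 * A.card - ev F A ≤ 2 * G.slowAux (fuel + 1) A by omega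
    by_cases h0 : ∃ v ∈ A, dg F A v = 0
    · obtain ⟨v, hv, hv0⟩ := h0
      refine slow_step G fuel _ A {v} (by simpa using hv) (by simp) ?_
      intro D hD hDne
      have hDv : D = {v} := hDne.subset_singleton_iff.1 hD.1
      subst hDv
      have := hone v hv
      rw [if_pos (by rw [hv0]; exact Even.zero), hv0] at this
      rw [card_singleton]
      omega
    push Not at h0
    obtain ⟨u, hu, a, ha, hua, hda, hor⟩ := exists_struct F hF A hne h3 h0
    have hne' : u ≠ a := hua.ne
    by_cases h2 : dg F A u ≤ 2
    · refine slow_step G fuel _ A {u, a} (by simp [insert_subset_iff, hu, ha]) (by simp) ?_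
      intro D hD hDne
      rw [card_pair hne']
      have hcase : D = {u} ∨ D = {a} := by
        have hnot : ¬ (u ∈ D ∧ a ∈ D) := fun h => hD.2.1 u h.1 a h.2 (hFG hua)
        have hsub := hD.1
        obtain ⟨x, hx⟩ := hDne
        have : ∀ y ∈ D, y = u ∨ y = a := fun y hy => by simpa using hsub hy
        rcases this x hx with rfl | rfl
        · left; ext y; rw [mem_singleton]; grind
        · right; ext y; rw [mem_singleton]; grind
      rcases hcase with rfl | rfl
      · have := hone u hu
        have h0u := h0 u hu
        by_cases hd : dg F A u = 2
        · rw [if_pos (by rw [hd]; decide), hd] at this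
          omega
        · have : dg F A u = 1 := by omega
          omega
      · have := hone a ha
        omega
    · obtain ⟨b, hb, hba, hub, hdb⟩ := hor.resolve_left h2
      have hub' : u ≠ b := hub.ne
      refine slow_step G fuel _ A {u, a, b} (by simp [insert_subset_iff, hu, ha, hb])
        (by simp) ?_
      intro D hD hDne
      have hc : ({u, a, b} : Finset W).card = 3 := by
        rw [card_eq_three]; exact ⟨u, a, b, hne', hub', hba.symm, rfl⟩
      rw [hc]
      have hcase : D = {u} ∨ D = {a} ∨ D = {b} ∨ D = {a, b} := by
        have hnot : ¬ (u ∈ D ∧ a ∈ D) := fun h => hD.2.1 u h.1 a h.2 (hFG hua)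
        have hnot' : ¬ (u ∈ D ∧ b ∈ D) := fun h => hD.2.1 u h.1 b h.2 (hFG hub)
        have hsub := hD.1
        obtain ⟨x, hx⟩ := hDne
        have hy : ∀ y ∈ D, y = u ∨ y = a ∨ y = b := fun y hy => by simpa using hsub hy
        by_cases h1 : u ∈ D
        · left; ext y; rw [mem_singleton]; grind
        by_cases h2 : a ∈ D
        · by_cases h3 : b ∈ D
          · right; right; right; ext y; simp only [mem_insert, mem_singleton]; grind
          · right; left; ext y; rw [mem_singleton]; grind
        · right; right; left; ext y; rw [mem_singleton]; grind
      rcases hcase with rfl | rfl | rfl | rfl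
      · have := hone u hu
        have := h3 u hu
        omega
      · have := hone a ha
        omega
      · have := hone b hb
        omega
      · have h5 := ih' {a, b} (by simp [insert_subset_iff, ha, hb]) (by simp)
        rw [card_pair hba.symm] at h5
        have hev : ev F (A \ {a, b}) ≤ ev F A := by
          apply card_le_card
          intro v hv
          simp only [mem_filter] at hv ⊢
          have hvA := (mem_sdiff.1 hv.1).1
          refine ⟨hvA, ?_⟩
          by_cases hvu : v = u
          · subst hvu
            have h6 : dg F (A \ {a, b}) v + 2 = dg F A v := by
              unfold dg
              have hsub : ({a, b} : Finset W) ⊆ A.filter (F.Adj v) := by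
                simp [insert_subset_iff, ha, hb, hua, hub]
              have := card_sdiff_add_card_eq_card hsub
              rw [card_pair hba.symm] at this
              rw [← this]
              congr 2
              ext y
              simp only [mem_filter, mem_sdiff]
              tauto
            rw [← h6]
            exact hv.2.add (by decide)
          · rw [← dg_eq F (D := {a, b}) v]
            · exact hv.2
            · intro x hx hvx
              simp only [mem_insert, mem_singleton] at hx
              rcases hx with rfl | rfl
              · exact hvu (leaf_unique F A hda hu hvA hua hvx)
              · exact hvu (leaf_unique F A hdb hu hvA hub hvx)
        omega

end

open Classical in
theorem exists_acyclic {W : Type*} [Fintype W] (F : SimpleGraph W) :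
    ∃ F' ≤ F, F'.IsAcyclic ∧
      ∀ v, (Odd (dg F' univ v) ↔ Odd (dg F univ v)) := by
  classical
  obtain ⟨F', hF'⟩ := (Set.toFinite {F' : SimpleGraph W | F' ≤ F ∧
    ∀ v, (Odd (dg F' univ v) ↔ Odd (dg F univ v))}).exists_minimal ⟨F, le_rfl, fun _ => Iff.rfl⟩
  obtain ⟨hle, hpar⟩ := hF'.prop
  refine ⟨F', hle, ?_, hpar⟩
  intro x c hc
  have hlt : F' \ c.toSubgraph.spanningCoe ∈ {F' : SimpleGraph W | F' ≤ F ∧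
    ∀ v, (Odd (dg F' univ v) ↔ Odd (dg F univ v))} := by
    refine ⟨sdiff_le.trans hle, ?_⟩
    intro v
    rw [← hpar v]
    have hsplit := card_filter_add_card_filter_not (s := univ.filter (F'.Adj v))
      (fun w => c.toSubgraph.Adj v w)
    have h1 : (univ.filter (F'.Adj v)).filter (fun w => ¬ c.toSubgraph.Adj v w) =
        univ.filter ((F' \ c.toSubgraph.spanningCoe).Adj v) := by
      ext w; simp
    have h2 : Even ((univ.filter (F'.Adj v)).filter (fun w => c.toSubgraph.Adj v w)).card := by
      have h3 : (univ.filter (F'.Adj v)).filter (fun w => c.toSubgraph.Adj v w) =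
          univ.filter (fun w => c.toSubgraph.Adj v w) := by
        ext w
        simp only [mem_filter, mem_univ, true_and, and_iff_right_iff_imp]
        exact fun h => c.toSubgraph.adj_sub h
      rw [h3]
      by_cases hv : v ∈ c.support
      · have := hc.ncard_neighborSet_toSubgraph_eq_two hv
        rw [Set.ncard_eq_toFinset_card'] at this
        have h4 : univ.filter (fun w => c.toSubgraph.Adj v w) =
            (c.toSubgraph.neighborSet v).toFinset := by
          ext w; simp
        rw [h4, this]; decide
      · have h4 : univ.filter (fun w => c.toSubgraph.Adj v w) = ∅ := by
          ext w
          simp only [mem_filter, mem_univ, true_and, notMem_empty, iff_false]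
          intro h
          exact hv ((c.mem_verts_toSubgraph).1 (c.toSubgraph.edge_vert h))
        rw [h4]; simp
    rw [h1] at hsplit
    unfold dg
    rw [← hsplit, Nat.odd_add', iff_true_right h2]
    convert Iff.rfl
  have hge := hF'.le_of_le hlt sdiff_le
  have hadj := c.toSubgraph_adj_snd hc.not_nil
  have := hge (c.toSubgraph.adj_sub hadj)
  rw [SimpleGraph.sdiff_adj] at this
  exact this.2 hadj

/-- blow-up of each vertex into a triangle -/
def blow {W : Type*} (H : SimpleGraph W) : SimpleGraph (W × Fin 3) where
  Adj x y := H.Adj x.1 y.1 ∨ (x.1 = y.1 ∧ x.2 ≠ y.2)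
  symm := ⟨by
    rintro x y (h | h)
    · exact Or.inl h.symm
    · exact Or.inr ⟨h.1.symm, h.2.symm⟩⟩
  loopless := ⟨by
    rintro x (h | h)
    · exact H.irrefl h
    · exact h.2 rfl⟩

theorem matching_fun {W : Type*} (H : SimpleGraph W) (M : H.Subgraph)
    (hM : M.IsPerfectMatching) :
    ∃ q : W → W, (∀ v, H.Adj v (q v)) ∧ ∀ v, q (q v) = v := by
  rw [SimpleGraph.Subgraph.isPerfectMatching_iff] at hM
  choose q hq hq' using hM
  exact ⟨q, fun v => M.adj_sub (hq v), fun v => (hq' (q v) v (M.adj_symm (hq v))).symm⟩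

theorem factor_of_blow {W : Type*} [Fintype W] (H : SimpleGraph W)
    (q : W × Fin 3 → W × Fin 3) (hq : ∀ x, (blow H).Adj x (q x)) (hqq : ∀ x, q (q x) = x) :
    ∃ F ≤ H, ∀ v, Odd (dg F univ v) ∧ dg F univ v ≤ 3 := by
  classical
  let N : W → W → ℕ := fun v w => (univ.filter (fun i : Fin 3 => (q (v, i)).1 = w)).card
  have hsym : ∀ v w, N v w ≤ N w v := by
    intro v w
    refine card_le_card_of_injOn (fun i => (q (v, i)).2) ?_ ?_
    · intro i hi
      simp only [coe_filter, mem_univ, true_and, Set.mem_ofPred_eq] at hi ⊢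
      have : (w, (q (v, i)).2) = q (v, i) := by rw [← hi]
      rw [this, hqq]
    · intro i hi j hj hij
      simp only [coe_filter, mem_univ, true_and, Set.mem_ofPred_eq] at hi hj
      have h1 : q (v, i) = q (v, j) := Prod.ext (hi.trans hj.symm) hij
      have h2 := congrArg q h1
      rw [hqq, hqq] at h2
      exact (Prod.ext_iff.1 h2).2
  have hself : ∀ v, Even (N v v) := by
    intro v
    refine even_card_invol _ (fun i => (q (v, i)).2) ?_ ?_ ?_
    · intro i hi
      simp only [mem_filter, mem_univ, true_and] at hi ⊢
      have : (v, (q (v, i)).2) = q (v, i) := Prod.ext hi.symm rfl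
      rw [this, hqq]
    · intro i hi h
      simp only [mem_filter, mem_univ, true_and] at hi
      have h1 : q (v, i) = (v, i) := Prod.ext hi h
      have := hq (v, i)
      rw [h1] at this
      exact (blow H).irrefl this
    · intro i hi
      simp only [mem_filter, mem_univ, true_and] at hi
      have : (v, (q (v, i)).2) = q (v, i) := Prod.ext hi.symm rfl
      simp only [this, hqq]
  let F : SimpleGraph W :=
    { Adj := fun v w => Odd (N v w)
      symm := ⟨fun v w h => by rwa [le_antisymm (hsym w v) (hsym v w)]⟩
      loopless := ⟨fun v h => by
        exact (Nat.not_even_iff_odd.2 h) (hself v)⟩ }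
  have hsum : ∀ v, ∑ w, N v w = 3 := by
    intro v
    have := card_eq_sum_card_fiberwise (s := (univ : Finset (Fin 3))) (t := (univ : Finset W))
      (f := fun i => (q (v, i)).1) (fun _ _ => by simp)
    rw [← this]; simp
  refine ⟨F, ?_, ?_⟩
  · intro v w h
    have hvw := F.ne_of_adj h
    have hodd : Odd (N v w) := h
    obtain ⟨i, hi⟩ := card_pos.1 hodd.pos
    simp only [mem_filter, mem_univ, true_and] at hi
    rcases hq (v, i) with h1 | h1
    · rw [hi] at h1; exact h1
    · exact absurd (h1.1.trans hi) hvw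
  · intro v
    have hdg : dg F univ v = (univ.filter (fun w => Odd (N v w))).card := by
      unfold dg
      congr 1
      ext w
      simp only [mem_filter, mem_univ, true_and]
      exact Iff.rfl
    constructor
    · rw [hdg, ← odd_sum_iff_odd_card_odd, hsum]; decide
    · rw [hdg, ← hsum v, card_filter]
      refine sum_le_sum fun w _ => ?_
      split_ifs with h
      · exact h.pos
      · exact Nat.zero_le _

theorem slow_bound {W : Type*} [Fintype W] [DecidableEq W] (H : SimpleGraph W)
    (M : (blow H).Subgraph) (hM : M.IsPerfectMatching) :
    3 * Fintype.card W ≤ 2 * H.sumColorCost := by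
  classical
  obtain ⟨q, hq, hqq⟩ := matching_fun _ M hM
  obtain ⟨F, hFH, hF⟩ := factor_of_blow H q hq hqq
  obtain ⟨F', hF'F, hac, hpar⟩ := exists_acyclic F
  have hdle : ∀ v, dg F' univ v ≤ dg F univ v := by
    intro v
    apply card_le_card
    intro w hw
    simp only [mem_filter, mem_univ, true_and] at hw ⊢
    exact hF'F hw
  have := potential H F' (hF'F.trans hFH) hac (Fintype.card W) univ (by simp)
    (fun v _ => (hdle v).trans (hF v).2)
  have hev : ev F' univ = 0 := by
    unfold ev
    rw [card_eq_zero, filter_eq_empty_iff]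
    intro v _
    rw [Nat.not_even_iff_odd, hpar]
    exact (hF v).1
  rw [hev, card_univ] at this
  exact this

theorem blow_matching {V : Type*} [Fintype V] [DecidableEq V]
    (G : SimpleGraph V) (k t : ℕ) (hk : 1 ≤ k)
    (hconn : ∀ S : Finset V, S.card < 3 * k →
      (G.induce ((Finset.univ \ S : Finset V) : Set V)).Connected)
    (p : V → V) (hp : ∀ v, G.Adj v (p v)) (hpp : ∀ v, p (p v) = v)
    (D : Finset V) (ht : t ≤ k) (hcard : D.card = 2 * t) :
    ∃ M : (blow (G.induce ((Finset.univ \ D : Finset V) : Set V))).Subgraph,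
      M.IsPerfectMatching := by
  classical
  set H := G.induce ((Finset.univ \ D : Finset V) : Set V) with hH
  have hnD : ∀ w : ((Finset.univ \ D : Finset V) : Set V), (w : V) ∉ D := by
    intro w hw
    have := w.2
    simp [hw] at this
  have hin : ∀ v, v ∉ D → v ∈ ((Finset.univ \ D : Finset V) : Set V) := by
    intro v hv; simp [hv]
  rw [SimpleGraph.tutte]
  intro U hU
  unfold SimpleGraph.IsTutteViolator at hU
  set K := ((⊤ : (blow H).Subgraph).deleteVerts U).coe with hK
  have hKadj : ∀ x y : ((⊤ : (blow H).Subgraph).deleteVerts U).verts,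
      (blow H).Adj x.1 y.1 → K.Adj x y := by
    intro x y h
    rw [hK, SimpleGraph.Subgraph.coe_adj, SimpleGraph.Subgraph.deleteVerts_adj]
    exact ⟨trivial, x.2.2, trivial, y.2.2, h⟩
  have hfib : ∀ x y : ((⊤ : (blow H).Subgraph).deleteVerts U).verts,
      x.1.1 = y.1.1 → K.Reachable x y := by
    intro x y h
    by_cases h2 : x.1.2 = y.1.2
    · have : x = y := Subtype.ext (Prod.ext h h2)
      rw [this]
    · exact (hKadj x y (Or.inr ⟨h, h2⟩)).reachable
  set S : Finset V := univ.filter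
    (fun v => ∃ h : v ∈ ((Finset.univ \ D : Finset V) : Set V), ∀ i, ((⟨v, h⟩, i) : _ × Fin 3) ∈ U)
    with hS
  set T : Finset V := univ.filter
    (fun v => ∃ h : v ∈ ((Finset.univ \ D : Finset V) : Set V), ∃ i, ((⟨v, h⟩, i) : _ × Fin 3) ∈ U)
    with hT
  by_cases hcase : (D ∪ S).card < 3 * k
  · have hc := hconn _ hcase
    -- lift reachability
    have hlift : ∀ a b : ((Finset.univ \ (D ∪ S) : Finset V) : Set V),
        Relation.ReflTransGen (G.induce ((Finset.univ \ (D ∪ S) : Finset V) : Set V)).Adj a b →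
        ∀ x y : ((⊤ : (blow H).Subgraph).deleteVerts U).verts,
        (x.1.1 : V) = a → (y.1.1 : V) = b → K.Reachable x y := by
      intro a b hab
      induction hab with
      | refl =>
        intro x y hx hy
        exact hfib x y (Subtype.ext (hx.trans hy.symm))
      | @tail b c _ hbc ih =>
        intro x y hx hy
        have hb := b.2
        simp only [coe_sdiff, coe_univ, coe_union, Set.mem_sdiff, Set.mem_univ, true_and,
          Set.mem_union, mem_coe, not_or] at hb
        have hb2 : ∃ i, ((⟨b, hin b hb.1⟩, i) : _ × Fin 3) ∉ U := by
          by_contra hcon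
          push Not at hcon
          exact hb.2 (mem_filter.2 ⟨mem_univ _, hin b hb.1, hcon⟩)
        obtain ⟨i, hi⟩ := hb2
        refine (ih x ⟨(⟨b, hin b hb.1⟩, i), trivial, hi⟩ hx rfl).trans ?_
        refine (hKadj _ _ (Or.inl ?_)).reachable
        change G.Adj b (y.1.1 : V)
        rw [hy]
        exact hbc
    have hout : ∀ x : ((⊤ : (blow H).Subgraph).deleteVerts U).verts,
        (x.1.1 : V) ∈ ((Finset.univ \ (D ∪ S) : Finset V) : Set V) := by
      intro x
      have h1 := hnD x.1.1
      have h2 : (x.1.1 : V) ∉ S := by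
        rw [hS, mem_filter]
        rintro ⟨_, h, hall⟩
        exact x.2.2 (hall x.1.2)
      simp [h1, h2]
    have hpre : ∀ x y, K.Reachable x y := by
      intro x y
      refine hlift ⟨_, hout x⟩ ⟨_, hout y⟩ ?_ x y rfl rfl
      rw [← SimpleGraph.reachable_iff_reflTransGen]
      exact hc.preconnected _ _
    have hle1 : K.oddComponents.ncard ≤ 1 := by
      rw [Set.ncard_le_one_iff]
      intro a b _ _
      induction a using SimpleGraph.ConnectedComponent.ind with | _ x
      induction b using SimpleGraph.ConnectedComponent.ind with | _ y
      exact SimpleGraph.ConnectedComponent.sound (hpre x y)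
    have hU0 : U.ncard = 0 := by omega
    have hUe : U = ∅ := (Set.ncard_eq_zero U.toFinite).1 hU0
    have hodd : Odd K.oddComponents.ncard := by
      have : K.oddComponents.ncard = 1 := by omega
      rw [this]; decide
    rw [SimpleGraph.odd_ncard_oddComponents] at hodd
    have hV : Even (Fintype.card V) := by
      rw [← card_univ]
      exact even_card_invol univ p (fun _ _ => mem_univ _)
        (fun a _ => (hp a).ne') (fun a _ => hpp a)
    have hcardK : Nat.card ((⊤ : (blow H).Subgraph).deleteVerts U).verts =
        (Fintype.card V - 2 * t) * 3 := by
      have : ((⊤ : (blow H).Subgraph).deleteVerts U).verts = Set.univ := by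
        rw [hUe]; simp
      rw [this, Nat.card_univ, Nat.card_prod, Nat.card_fin]
      congr 1
      rw [Nat.card_coe_set_eq, Set.ncard_coe_finset, card_sdiff_of_subset (subset_univ _),
        card_univ, hcard]
    rw [hcardK] at hodd
    obtain ⟨r, hr⟩ := hodd
    obtain ⟨s, hs⟩ := hV
    omega
  · have hSt : t ≤ S.card := by
      have := card_union_le D S
      omega
    have hex : ∀ c ∈ K.oddComponents, ∃ x ∈ c.supp, p (x.1.1 : V) ∈ D ∪ T := by
      intro c hc
      by_contra hcon
      push Not at hcon
      have hgood : ∀ x ∈ c.supp, p (x.1.1 : V) ∉ D ∧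
          ∀ h : p (x.1.1 : V) ∈ ((Finset.univ \ D : Finset V) : Set V),
            ∀ i, ((⟨p (x.1.1 : V), h⟩, i) : _ × Fin 3) ∉ U := by
        intro x hx
        have := hcon x hx
        rw [mem_union, not_or] at this
        refine ⟨this.1, fun h i hi => this.2 ?_⟩
        rw [hT, mem_filter]
        exact ⟨mem_univ _, h, i, hi⟩
      let g : ((⊤ : (blow H).Subgraph).deleteVerts U).verts →
          ((⊤ : (blow H).Subgraph).deleteVerts U).verts := fun x =>
        if h : ∃ h : p (x.1.1 : V) ∈ ((Finset.univ \ D : Finset V) : Set V),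
          ((⟨p (x.1.1 : V), h⟩, x.1.2) : _ × Fin 3) ∉ U then
          ⟨(⟨p (x.1.1 : V), h.1⟩, x.1.2), trivial, h.2⟩ else x
      have hg1 : ∀ x ∈ c.supp, ((g x).1.1 : V) = p (x.1.1 : V) ∧ (g x).1.2 = x.1.2 := by
        intro x hx
        have h := hgood x hx
        have h' : ∃ h : p (x.1.1 : V) ∈ ((Finset.univ \ D : Finset V) : Set V),
          ((⟨p (x.1.1 : V), h⟩, x.1.2) : _ × Fin 3) ∉ U := ⟨hin _ h.1, h.2 _ _⟩
        simp only [g, dif_pos h']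
        exact ⟨trivial, trivial⟩
      have hgm : ∀ x ∈ c.supp, g x ∈ c.supp := by
        intro x hx
        have hadj : K.Adj x (g x) := by
          apply hKadj
          left
          change G.Adj (x.1.1 : V) ((g x).1.1 : V)
          rw [(hg1 x hx).1]
          exact hp _
        rw [SimpleGraph.ConnectedComponent.mem_supp_iff] at hx ⊢
        rw [← hx]
        exact SimpleGraph.ConnectedComponent.sound hadj.symm.reachable
      have hev : Even (c.supp.toFinset).card := by
        refine even_card_invol _ g ?_ ?_ ?_
        · intro x hx
          rw [Set.mem_toFinset] at hx ⊢
          exact hgm x hx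
        · intro x hx h
          rw [Set.mem_toFinset] at hx
          have h1 := (hg1 x hx).1
          rw [h] at h1
          exact (hp _).ne h1
        · intro x hx
          rw [Set.mem_toFinset] at hx
          have h1 := hg1 x hx
          have h2 := hg1 (g x) (hgm x hx)
          refine Subtype.ext (Prod.ext (Subtype.ext ?_) ?_)
          · rw [h2.1, h1.1, hpp]
          · rw [h2.2, h1.2]
      have hc' : Odd c.supp.ncard := hc
      rw [Set.ncard_eq_toFinset_card'] at hc'
      exact (Nat.not_even_iff_odd.2 hc') hev
    have hex' : ∀ c : K.ConnectedComponent, ∃ x, c ∈ K.oddComponents →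
        x ∈ c.supp ∧ p (x.1.1 : V) ∈ D ∪ T := by
      intro c
      by_cases hc : c ∈ K.oddComponents
      · obtain ⟨x, h1, h2⟩ := hex c hc
        exact ⟨x, fun _ => ⟨h1, h2⟩⟩
      · obtain ⟨x, _⟩ := c.exists_rep
        exact ⟨x, fun h => absurd h hc⟩
    choose x hx' using hex'
    have hx := fun c hc => (hx' c hc).1
    have hxp := fun c hc => (hx' c hc).2
    have h1 : K.oddComponents.ncard ≤ (D ∪ T).card := by
      rw [← Set.ncard_coe_finset]
      refine Set.ncard_le_ncard_of_injOn (fun c => p ((x c).1.1 : V))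
        (fun c hc => by exact hxp c hc) ?_ (Set.toFinite _)
      intro c hc c' hc' h
      have h2 : ((x c).1.1 : V) = ((x c').1.1 : V) := by
        have := congrArg p h
        simpa only [hpp] using this
      have h3 := hfib (x c) (x c') (Subtype.ext h2)
      have e1 := hx c hc
      have e2 := hx c' hc'
      rw [SimpleGraph.ConnectedComponent.mem_supp_iff] at e1 e2
      rw [← e1, ← e2]
      exact SimpleGraph.ConnectedComponent.sound h3
    have h2 : T.card + 2 * S.card ≤ U.ncard := by
      rw [Set.ncard_eq_toFinset_card',
        card_eq_sum_card_fiberwise (s := U.toFinset) (t := (univ : Finset V))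
          (f := fun y => (y.1 : V)) (fun _ _ => by simp), hS, hT, card_filter, card_filter,
          mul_sum, ← sum_add_distrib]
      refine sum_le_sum fun w _ => ?_
      by_cases hw : ∃ h : w ∈ ((Finset.univ \ D : Finset V) : Set V),
          ∀ i, ((⟨w, h⟩, i) : _ × Fin 3) ∈ U
      · obtain ⟨h, hall⟩ := hw
        have h3 : (univ : Finset (Fin 3)).card ≤
            (U.toFinset.filter (fun y => (y.1 : V) = w)).card := by
          refine card_le_card_of_injOn (fun i => (⟨w, h⟩, i)) ?_ ?_
          · intro i _
            simp [hall i]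
          · intro i _ j _ hij
            exact (Prod.ext_iff.1 hij).2
        rw [card_univ, Fintype.card_fin] at h3
        split_ifs <;> omega
      · rw [if_neg hw]
        split_ifs with hw2
        · obtain ⟨h, i, hi⟩ := hw2
          have : 0 < (U.toFinset.filter (fun y => (y.1 : V) = w)).card :=
            card_pos.2 ⟨(⟨w, h⟩, i), by simp [hi]⟩
          omega
        · omega
    have h3 := card_union_le D T
    omega

end SlowAux

/-- If `k ≥ 1`, `G` is `3k`-connected on `n ≥ 4k` vertices with a perfect
matching `M`, and `D` is an independent set containing at most one endpoint of
each matching edge with `|D| = 2t`, `t ≤ k`, then `2·𝓈(G − D) ≥ 3n − 6t`. -/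
theorem slow_coloring_delete_even {V : Type*} [Fintype V] [DecidableEq V]
    (G : SimpleGraph V) (k t : ℕ) (hk : 1 ≤ k)
    (hconn : G.MConnected (3 * k)) (hn : 4 * k ≤ Fintype.card V)
    (M : G.Subgraph) (hM : M.IsPerfectMatching)
    (D : Finset V) (hind : ∀ u ∈ D, ∀ v ∈ D, ¬ G.Adj u v)
    (hDM : ∀ u v : V, M.Adj u v → u ∈ D → v ∉ D)
    (ht : t ≤ k) (hcard : D.card = 2 * t) :
    3 * Fintype.card V ≤
      2 * (G.induce ((Finset.univ \ D : Finset V) : Set V)).sumColorCost + 6 * t := by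
  obtain ⟨p, hp, hpp⟩ := SlowAux.matching_fun G M hM
  obtain ⟨M', hM'⟩ := SlowAux.blow_matching G k t hk hconn.2 p hp hpp D ht hcard
  have h := SlowAux.slow_bound _ M' hM'
  have hc : Fintype.card ((Finset.univ \ D : Finset V) : Set V) = Fintype.card V - 2 * t := by
    rw [← Nat.card_eq_fintype_card, Nat.card_coe_set_eq, Set.ncard_coe_finset,
      Finset.card_sdiff_of_subset (Finset.subset_univ _), Finset.card_univ, hcard]
  have hle : D.card ≤ Fintype.card V := Finset.card_le_univ D
  rw [hc] at h
  have h' : 3 * (Fintype.card V - 2 * t) ≤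
      2 * (G.induce ((Finset.univ \ D : Finset V) : Set V)).sumColorCost := by
    convert h
  omega
end

section
/- Let k ≥ 1 and let G be a 3k-connected finite simple graph with n = |V(G)| ≥ 4k vertices and a perfect matching M. Let D be an independent set of vertices of G containing at most one endpoint of each edge of M, with |D| ≤ 2k. Then 2·𝓈(G − D) ≥ 3n − 6k (i.e., 𝓈(G − D) ≥ 3n/2 − 3k). -/
/-! Definitions for the slow coloring game (sum-color cost), paintability,
connectivity and auxiliary graphs. -/

variable {V : Type*}

namespace SlowDel
open Finset
open scoped Classical

/-- Degree of a vertex, counted classically. -/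
noncomputable def dg {W : Type*} [Fintype W] (F : SimpleGraph W) (v : W) : ℕ :=
  (univ.filter (fun w => F.Adj v w)).card

/-- Number of vertices in `A` with even degree in `F`. -/
noncomputable def ev {W : Type*} [Fintype W] (F : SimpleGraph W) (A : Finset W) : ℕ :=
  (A.filter (fun v => Even (dg F v))).card

lemma ev_le {W : Type*} [Fintype W] (F F' : SimpleGraph W) (A A' Q : Finset W) (hA : A' ⊆ A)
    (h : ∀ v ∈ A', v ∉ Q → Even (dg F' v) → Even (dg F v)) :
    ev F' A' ≤ ev F A + Q.card := by
  unfold ev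
  refine le_trans (card_le_card (t := A.filter (fun v => Even (dg F v)) ∪ Q) ?_) (card_union_le _ _)
  intro v hv
  simp only [mem_filter, mem_union] at *
  by_cases hq : v ∈ Q
  · exact Or.inr hq
  · exact Or.inl ⟨hA hv.1, h v hv.1 hq hv.2⟩

/-- `F` with the vertices in `D` isolated. -/
def del {W : Type*} (F : SimpleGraph W) (D : Finset W) : SimpleGraph W where
  Adj v w := F.Adj v w ∧ v ∉ D ∧ w ∉ D
  symm := ⟨fun _ _ h => ⟨h.1.symm, h.2.2, h.2.1⟩⟩
  loopless := ⟨fun _ h => F.loopless.irrefl _ h.1⟩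

lemma dg_mono {W : Type*} [Fintype W] {F F' : SimpleGraph W} (h : F' ≤ F) (v : W) :
    dg F' v ≤ dg F v := by
  unfold dg
  apply card_le_card
  intro w hw
  simp only [mem_filter, mem_univ, true_and] at *
  exact h hw

lemma leaf {W : Type*} [Fintype W] (K : SimpleGraph W) (hK : K.IsAcyclic) (t : W) :
    ∃ v z, (v = t ∨ ∃ w, K.Adj v w) ∧ ∀ w, K.Adj v w → w = z := by
  have hb : ∀ n, (∃ v, ∃ p : K.Walk t v, p.IsPath ∧ p.length = n) → n ≤ Fintype.card W := by
    rintro n ⟨v, p, hp, rfl⟩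
    exact hp.length_lt.le
  have hex : ∃ n, (∃ v, ∃ p : K.Walk t v, p.IsPath ∧ p.length = n) :=
    ⟨0, t, SimpleGraph.Walk.nil, by simp, rfl⟩
  obtain ⟨n0, h0⟩ := hex
  have hs := Nat.findGreatest_spec (P := fun n => ∃ v, ∃ p : K.Walk t v, p.IsPath ∧ p.length = n)
    (hb n0 h0) h0
  have hm : ∀ n, (∃ v, ∃ p : K.Walk t v, p.IsPath ∧ p.length = n) → n ≤ Nat.findGreatest
      (fun n => ∃ v, ∃ p : K.Walk t v, p.IsPath ∧ p.length = n) (Fintype.card W) :=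
    fun n hn => Nat.le_findGreatest (hb n hn) hn
  obtain ⟨v, p, hp, hl⟩ := hs
  rw [← hl] at hm
  refine ⟨v, p.penultimate, ?_, ?_⟩
  · by_cases hv : v = t
    · exact Or.inl hv
    · right
      refine ⟨p.penultimate, (p.adj_penultimate ?_).symm⟩
      intro h
      exact hv h.eq.symm
  · intro w hw
    by_cases hws : w ∈ p.support
    · exact hK.eq_penultimate_of_adj_end hp hw hws
    · have := hm (p.length + 1) ⟨w, p.concat hw, hp.concat hws hw, by simp⟩
      omega

lemma exists_maxIndep {W : Type*} (H : SimpleGraph W) (M : Finset W) :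
    ∃ D, H.MaxIndepSubset M D := by
  obtain ⟨D, hD, hmax⟩ := Finset.exists_max_image
    (M.powerset.filter (fun D => ∀ u ∈ D, ∀ v ∈ D, ¬ H.Adj u v)) Finset.card
    ⟨∅, by simp⟩
  simp only [mem_filter, mem_powerset] at hD hmax
  refine ⟨D, hD.1, hD.2, ?_⟩
  intro v hv hvD
  by_contra! hcon
  have := hmax (insert v D) ⟨insert_subset hv hD.1, by
    intro a ha b hb hab
    rcases mem_insert.1 ha with h1 | h1 <;> rcases mem_insert.1 hb with h2 | h2
    · exact hab.ne (h1.trans h2.symm)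
    · exact hcon b h2 (h1 ▸ hab.symm)
    · exact hcon a h1 (h2 ▸ hab)
    · exact hD.2 a h1 b h2 hab⟩
  rw [card_insert_of_notMem hvD] at this
  omega

lemma step {W : Type*} [Fintype W] [DecidableEq W] (H : SimpleGraph W) (fuel : ℕ) (A : Finset W)
    (M : Finset W) (hMA : M ⊆ A) (hM : M.Nonempty) (b : ℕ)
    (h : ∀ D, H.MaxIndepSubset M D → b ≤ M.card + H.slowAux fuel (A \ D)) :
    b ≤ H.slowAux (fuel + 1) A := by
  rw [SimpleGraph.slowAux]
  refine le_trans ?_ (Finset.le_sup (f := fun M : Finset W => M.card + sInf {m | ∃ D : Finset W, H.MaxIndepSubset M D ∧ m = H.slowAux fuel (A \ D)}) (b := M) (by simp [hMA, hM]))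
  by_cases hne : {m | ∃ D : Finset W, H.MaxIndepSubset M D ∧ m = H.slowAux fuel (A \ D)}.Nonempty
  · obtain ⟨D, hD, he⟩ := Nat.sInf_mem hne
    rw [he]; exact h D hD
  · exfalso
    apply hne
    obtain ⟨D, hD⟩ := exists_maxIndep H M
    exact ⟨_, D, hD, rfl⟩

lemma del_adj {W : Type*} (F : SimpleGraph W) (D : Finset W) (v w : W) :
    (del F D).Adj v w ↔ F.Adj v w ∧ v ∉ D ∧ w ∉ D := Iff.rfl

lemma del_le {W : Type*} (F : SimpleGraph W) (D : Finset W) : del F D ≤ F := fun _ _ h => h.1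

lemma dg_del {W : Type*} [Fintype W] (F : SimpleGraph W) (D : Finset W) (v : W) (hv : v ∉ D) :
    dg F v = dg (del F D) v + (D.filter (fun w => F.Adj v w)).card := by
  unfold dg
  rw [← card_union_of_disjoint]
  · congr 1
    ext w
    simp only [mem_filter, mem_univ, true_and, mem_union, del_adj]
    tauto
  · rw [disjoint_left]
    intro w h1 h2
    simp only [mem_filter, mem_univ, true_and, del_adj] at *
    exact h1.2.2 h2.1

/-- Statement proved by induction on fuel. -/
def Game {W : Type*} [Fintype W] [DecidableEq W] (H : SimpleGraph W) (fuel : ℕ) : Prop :=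
  ∀ (A : Finset W) (F : SimpleGraph W), A.card ≤ fuel → F ≤ H → (∀ v w, F.Adj v w → v ∈ A) →
    (∀ v, dg F v ≤ 3) → 3 * A.card ≤ 2 * H.slowAux fuel A + ev F A

lemma fstep {W : Type*} [Fintype W] [DecidableEq W] (H : SimpleGraph W) (fuel : ℕ)
    (IH : Game H fuel) (A : Finset W) (F : SimpleGraph W) (hc : A.card ≤ fuel + 1) (hF : F ≤ H)
    (hA : ∀ v w, F.Adj v w → v ∈ A) (hd : ∀ v, dg F v ≤ 3)
    (M : Finset W) (hMA : M ⊆ A) (hM : M.Nonempty)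
    (h : ∀ D, H.MaxIndepSubset M D →
      ev (del F D) (A \ D) + 3 * D.card ≤ ev F A + 2 * M.card) :
    3 * A.card ≤ 2 * H.slowAux (fuel + 1) A + ev F A := by
  have key : (3 * A.card - ev F A + 1) / 2 ≤ H.slowAux (fuel + 1) A := by
    apply step H fuel A M hMA hM
    intro D hD
    have h1 := h D hD
    have hDA : D ⊆ A := hD.1.trans hMA
    have hDne : D.Nonempty := by
      obtain ⟨v, hv⟩ := hM
      by_cases hvD : v ∈ D
      · exact ⟨v, hvD⟩
      · obtain ⟨u, hu, _⟩ := hD.2.2 v hv hvD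
        exact ⟨u, hu⟩
    have hcard := card_sdiff_add_card_eq_card hDA
    have hpos := hDne.card_pos
    have h2 := IH (A \ D) (del F D) (by omega) (fun v w hvw => hF hvw.1)
      (fun v w hvw => mem_sdiff.2 ⟨hA v w hvw.1, hvw.2.1⟩)
      (fun v => (dg_mono (del_le F D) v).trans (hd v))
    omega
  omega

lemma ev_del {W : Type*} [Fintype W] [DecidableEq W] (F : SimpleGraph W) (A D Q : Finset W)
    (h : ∀ v, v ∉ D → v ∉ Q → Even (D.filter (fun w => F.Adj v w)).card) :
    ev (del F D) (A \ D) ≤ ev F A + Q.card := by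
  apply ev_le _ _ _ _ _ sdiff_subset
  intro v hv hq he
  have hvD := (mem_sdiff.1 hv).2
  rw [dg_del F D v hvD]
  exact he.add (h v hvD hq)

lemma ev_del_single {W : Type*} [Fintype W] [DecidableEq W] (F : SimpleGraph W) (A : Finset W)
    (x : W) : ev (del F {x}) (A \ {x}) ≤ ev F A + dg F x := by
  apply ev_del
  intro v hv hq
  rw [filter_singleton]
  have : ¬ F.Adj v x := fun h => hq (by simp [h.symm])
  simp [this]

lemma game_zero {W : Type*} [Fintype W] [DecidableEq W] (H : SimpleGraph W) : Game H 0 := by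
  intro A F hc _ _ _
  omega

lemma ev_cycle {W : Type*} [Fintype W] (F : SimpleGraph W) (u : W) (p : F.Walk u u)
    (hp : p.IsCycle) (v : W) :
    dg F v = dg (F \ p.toSubgraph.spanningCoe) v ∨
      dg F v = dg (F \ p.toSubgraph.spanningCoe) v + 2 := by
  have h1 : dg F v = dg (F \ p.toSubgraph.spanningCoe) v + (p.toSubgraph.neighborSet v).ncard := by
    unfold dg
    rw [Set.ncard_eq_toFinset_card', ← card_union_of_disjoint]
    · congr 1
      ext w
      have : p.toSubgraph.Adj v w → F.Adj v w := fun h => h.adj_sub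
      simp only [mem_filter, mem_univ, true_and, mem_union, Set.mem_toFinset,
        SimpleGraph.sdiff_adj, SimpleGraph.Subgraph.spanningCoe_adj,
        SimpleGraph.Subgraph.mem_neighborSet]
      tauto
    · rw [disjoint_left]
      intro w h1 h2
      simp only [mem_filter, mem_univ, true_and, Set.mem_toFinset,
        SimpleGraph.sdiff_adj, SimpleGraph.Subgraph.spanningCoe_adj,
        SimpleGraph.Subgraph.mem_neighborSet] at *
      exact h1.2 h2
  by_cases hv : v ∈ p.support
  · right
    rw [h1, hp.ncard_neighborSet_toSubgraph_eq_two hv]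
  · left
    have : p.toSubgraph.neighborSet v = ∅ := by
      ext w
      simp only [SimpleGraph.Subgraph.mem_neighborSet, Set.mem_empty_iff_false, iff_false]
      intro h
      exact hv (p.mem_verts_toSubgraph.1 h.fst_mem)
    rw [h1, this]; simp

lemma eq_of_dg_one {W : Type*} [Fintype W] {F : SimpleGraph W} {x c : W} (h : dg F x = 1)
    (hc : F.Adj x c) (w : W) (hw : F.Adj x w) : w = c := by
  unfold dg at h
  exact card_le_one.1 h.le w (by simpa using hw) c (by simpa using hc)

lemma game_succ {W : Type*} [Fintype W] [DecidableEq W] (H : SimpleGraph W) (fuel : ℕ)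
    (IH : Game H fuel) : Game H (fuel + 1) := by
  intro A F hc hF hA hd
  induction hn : F.edgeSet.ncard using Nat.strong_induction_on generalizing F with
  | _ n ih =>
  subst hn
  have red : ∀ F' : SimpleGraph W, F' < F → ev F' A ≤ ev F A →
      3 * A.card ≤ 2 * H.slowAux (fuel + 1) A + ev F A := by
    intro F' hlt hev
    have := ih F'.edgeSet.ncard (Set.ncard_lt_ncard (SimpleGraph.edgeSet_ssubset_edgeSet.2 hlt))
      F' (hlt.le.trans hF) (fun v w h => hA v w (hlt.le h))
      (fun v => (dg_mono hlt.le v).trans (hd v)) rfl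
    omega
  -- empty
  by_cases hA0 : A = ∅
  · subst hA0; simp
  -- degree two vertices
  by_cases h2 : ∃ p, dg F p = 2
  · obtain ⟨p, hp⟩ := h2
    obtain ⟨q, hq⟩ : ∃ q, F.Adj p q := by
      have : (univ.filter (fun w => F.Adj p w)).Nonempty := by
        rw [← card_pos]; unfold dg at hp; omega
      obtain ⟨q, hq⟩ := this
      exact ⟨q, by simpa using hq⟩
    have hadj : ∀ a b, (F.deleteEdges {s(p, q)}).Adj a b ↔
        F.Adj a b ∧ ¬ ((a = p ∧ b = q) ∨ (a = q ∧ b = p)) := by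
      intro a b
      simp [SimpleGraph.deleteEdges_adj]
    have hle : F.deleteEdges {s(p, q)} ≤ F := F.deleteEdges_le _
    refine red (F.deleteEdges {s(p, q)}) (lt_of_le_of_ne hle ?_) ?_
    · intro h
      have h3 := (hadj p q)
      rw [h] at h3
      exact (h3.1 hq).2 (by simp)
    · have hpne : ∀ v, v ≠ p → v ≠ q → dg (F.deleteEdges {s(p, q)}) v = dg F v := by
        intro v h1 h2
        unfold dg
        congr 1
        ext w
        simp only [mem_filter, mem_univ, true_and]
        rw [hadj]; tauto
      have hpp : dg F p = dg (F.deleteEdges {s(p, q)}) p + 1 := by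
        unfold dg
        rw [← card_insert_of_notMem (a := q)]
        · congr 1
          ext w
          simp only [mem_filter, mem_univ, true_and, mem_insert]
          rw [hadj]
          constructor
          · intro h
            by_cases hw : w = q
            · exact Or.inl hw
            · refine Or.inr ⟨h, ?_⟩
              rintro (h | h)
              · exact hw h.2
              · exact hq.ne h.1
          · rintro (rfl | h)
            · exact hq
            · exact h.1
        · simp only [mem_filter, mem_univ, true_and]
          rw [hadj]; simp
      have hpA := hA p q hq
      unfold ev
      calc _ ≤ (insert q ((A.filter (fun v => Even (dg F v))).erase p)).card := by
            apply card_le_card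
            intro v hv
            simp only [mem_filter, mem_insert, mem_erase] at *
            by_cases hvq : v = q
            · exact Or.inl hvq
            · right
              have hvp : v ≠ p := by
                rintro rfl
                have h1 := hv.2
                have : dg (F.deleteEdges {s(v, q)}) v = 1 := by omega
                rw [this] at h1
                exact absurd h1 (by decide)
              refine ⟨hvp, hv.1, ?_⟩
              rw [← hpne v hvp hvq]; exact hv.2
        _ ≤ _ := by
            refine (card_insert_le _ _).trans ?_
            have hmem : p ∈ A.filter (fun v => Even (dg F v)) := by
              simp [hpA, hp]
            rw [card_erase_add_one hmem]
  push Not at h2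
  by_cases hac : F.IsAcyclic
  swap
  · unfold SimpleGraph.IsAcyclic at hac
    push Not at hac
    obtain ⟨u, p, hp⟩ := hac
    refine red (F \ p.toSubgraph.spanningCoe) (lt_of_le_of_ne sdiff_le ?_) ?_
    · intro h
      have h1 := hp.ncard_neighborSet_toSubgraph_eq_two p.start_mem_support
      have : (p.toSubgraph.neighborSet u).Nonempty := by
        apply Set.nonempty_of_ncard_ne_zero; omega
      obtain ⟨w, hw⟩ := this
      have hFa : F.Adj u w := hw.adj_sub
      rw [← h] at hFa
      exact hFa.2 hw
    · have := ev_le F (F \ p.toSubgraph.spanningCoe) A A ∅ (subset_refl _) (by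
        intro v _ _ he
        rcases ev_cycle F u p hp v with h | h
        · rwa [h]
        · rw [h]; exact he.add (by decide))
      simpa using this
  have nbr : ∀ v w, F.Adj v w → dg F v = 1 ∨ dg F v = 3 := by
    intro v w h
    have h1 := hd v
    have h2 := h2 v
    have : 0 < dg F v := card_pos.2 ⟨w, by simpa using h⟩
    omega
  by_cases h3 : ∃ t, dg F t = 3
  · obtain ⟨t, ht⟩ := h3
    let K : SimpleGraph W :=
      { Adj := fun v w => F.Adj v w ∧ dg F v = 3 ∧ dg F w = 3
        symm := ⟨fun _ _ h => ⟨h.1.symm, h.2.2, h.2.1⟩⟩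
        loopless := ⟨fun _ h => F.loopless.irrefl _ h.1⟩ }
    have hK : K.IsAcyclic := hac.anti (fun v w h => h.1)
    obtain ⟨c, z, hcz, hz⟩ := leaf K hK t
    have hc3 : dg F c = 3 := by
      rcases hcz with rfl | ⟨w, hw⟩
      · exact ht
      · exact hw.2.1
    obtain ⟨x, hx, y, hy, hxy⟩ : ∃ x ∈ (univ.filter (fun w => F.Adj c w)).erase z,
        ∃ y ∈ (univ.filter (fun w => F.Adj c w)).erase z, x ≠ y := by
      apply one_lt_card.1
      have := pred_card_le_card_erase (s := univ.filter (fun w => F.Adj c w)) (a := z)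
      unfold dg at hc3
      omega
    simp only [mem_erase, mem_filter, mem_univ, true_and] at hx hy
    have lf : ∀ x, x ≠ z → F.Adj c x → dg F x = 1 := by
      intro x hxz hcx
      rcases nbr x c hcx.symm with h | h
      · exact h
      · exact absurd (hz x ⟨hcx, hc3, h⟩) hxz
    have hx1 := lf x hx.1 hx.2
    have hy1 := lf y hy.1 hy.2
    have hcx := hx.2.ne
    have hcy := hy.2.ne
    have hMc : ({c, x, y} : Finset W).card = 3 := by
      rw [card_eq_three]; exact ⟨c, x, y, hcx, hcy, hxy, rfl⟩
    refine fstep H fuel IH A F hc hF hA hd {c, x, y} ?_ (by simp) ?_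
    · intro v hv
      simp only [mem_insert, mem_singleton] at hv
      rcases hv with rfl | rfl | rfl
      · exact hA _ _ hx.2
      · exact hA _ _ hx.2.symm
      · exact hA _ _ hy.2.symm
    · intro D hD
      rw [hMc]
      have hcase : D = {c} ∨ D = {x} ∨ D = {y} ∨ D = {x, y} := by
        obtain ⟨hs, hi, hm⟩ := hD
        have m1 : ∀ v ∈ D, v = c ∨ v = x ∨ v = y := by
          intro v hv; simpa using hs hv
        by_cases hcD : c ∈ D
        · left
          ext v
          simp only [mem_singleton]
          constructor
          · intro hv
            rcases m1 v hv with h | rfl | rfl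
            · exact h
            · exact absurd (hF hx.2) (hi _ hcD _ hv)
            · exact absurd (hF hy.2) (hi _ hcD _ hv)
          · rintro rfl; exact hcD
        · right
          obtain ⟨u, hu, _⟩ := hm c (by simp) hcD
          by_cases hxD : x ∈ D <;> by_cases hyD : y ∈ D
          · right; right
            ext v
            simp only [mem_insert, mem_singleton]
            grind
          · left
            ext v
            simp only [mem_singleton]
            grind
          · right; left
            ext v
            simp only [mem_singleton]
            grind
          · grind
      rcases hcase with rfl | rfl | rfl | rfl
      · have := ev_del_single F A c
        rw [card_singleton]; omega
      · have := ev_del_single F A x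
        rw [card_singleton]; omega
      · have := ev_del_single F A y
        rw [card_singleton]; omega
      · have := ev_del F A {x, y} ∅ (by
          intro v hv _
          by_cases hvc : v = c
          · subst hvc
            have : ({x, y} : Finset W).filter (fun w => F.Adj v w) = {x, y} := by
              apply filter_true_of_mem
              intro w hw
              simp only [mem_insert, mem_singleton] at hw
              rcases hw with rfl | rfl
              · exact hx.2
              · exact hy.2
            rw [this, card_pair hxy]; decide
          · have : ({x, y} : Finset W).filter (fun w => F.Adj v w) = ∅ := by
              apply filter_false_of_mem
              intro w hw hvw
              simp only [mem_insert, mem_singleton] at hw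
              rcases hw with rfl | rfl
              · exact hvc (eq_of_dg_one hx1 hx.2.symm v hvw.symm)
              · exact hvc (eq_of_dg_one hy1 hy.2.symm v hvw.symm)
            rw [this]; simp)
        rw [card_empty] at this
        rw [card_pair hxy]; omega
  · push Not at h3
    by_cases he : ∃ x y, F.Adj x y
    · obtain ⟨x, y, hxy⟩ := he
      have hx1 := (nbr x y hxy).resolve_right (h3 x)
      have hy1 := (nbr y x hxy.symm).resolve_right (h3 y)
      refine fstep H fuel IH A F hc hF hA hd {x, y} ?_ (by simp) ?_
      · intro v hv
        simp only [mem_insert, mem_singleton] at hv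
        rcases hv with rfl | rfl
        · exact hA _ _ hxy
        · exact hA _ _ hxy.symm
      · intro D hD
        rw [card_pair hxy.ne]
        have hcase : D = {x} ∨ D = {y} := by
          obtain ⟨hs, hi, hm⟩ := hD
          have m1 : ∀ v ∈ D, v = x ∨ v = y := by
            intro v hv; simpa using hs hv
          have hH := hF hxy
          by_cases hxD : x ∈ D
          · left
            ext v
            simp only [mem_singleton]
            grind
          · right
            obtain ⟨u, hu, _⟩ := hm x (by simp) hxD
            ext v
            simp only [mem_singleton]
            grind
        rcases hcase with rfl | rfl
        · have := ev_del_single F A x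
          rw [card_singleton]; omega
        · have := ev_del_single F A y
          rw [card_singleton]; omega
    · push Not at he
      obtain ⟨x, hx⟩ := nonempty_iff_ne_empty.2 hA0
      have h0 : ∀ (B : Finset W) (F' : SimpleGraph W), F' ≤ F → ev F' B = B.card := by
        intro B F' hle
        unfold ev
        rw [filter_true_of_mem]
        intro v _
        have : dg F' v = 0 := by
          unfold dg
          rw [card_eq_zero, filter_eq_empty_iff]
          intro w _ h
          exact he _ _ (hle h)
        rw [this]; decide
      refine fstep H fuel IH A F hc hF hA hd {x} (by simpa using hx) (by simp) ?_
      intro D hD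
      have hD1 : D ⊆ {x} := hD.1
      have hDx : D = {x} := by
        rcases subset_singleton_iff.1 hD1 with h | h
        · obtain ⟨u, hu, _⟩ := hD.2.2 x (by simp) (by simp [h])
          simp [h] at hu
        · exact h
      subst hDx
      rw [h0 _ _ (del_le F _), h0 _ _ le_rfl, card_singleton]
      have := card_sdiff_add_card_eq_card (s := {x}) (t := A) (by simpa using hx)
      rw [card_singleton] at this
      omega

lemma game {W : Type*} [Fintype W] [DecidableEq W] (H : SimpleGraph W) (fuel : ℕ) :
    Game H fuel := by
  induction fuel with
  | zero => exact game_zero H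
  | succ n ih => exact game_succ H n ih

lemma even_of_inv {α : Type*} (s : Finset α) (g : α → α) (h1 : ∀ a ∈ s, g a ∈ s)
    (h2 : ∀ a ∈ s, g (g a) = a) (h3 : ∀ a ∈ s, g a ≠ a) : Even s.card := by
  have h : ∑ _x ∈ s, (1 : ZMod 2) = 0 :=
    Finset.sum_involution (fun a _ => g a) (fun _ _ => by decide) (fun a ha _ => h3 a ha)
      (fun a ha => h1 a ha) (fun a ha => h2 a ha)
  simp only [sum_const, nsmul_eq_mul, mul_one] at h
  exact (ZMod.natCast_eq_zero_iff_even).1 h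

/-- The blow-up of `H` by triangles. -/
def blow {W : Type*} (H : SimpleGraph W) : SimpleGraph (W × Fin 3) where
  Adj a b := H.Adj a.1 b.1 ∨ (a.1 = b.1 ∧ a ≠ b)
  symm := ⟨fun _ _ h => h.imp (fun h => h.symm) (fun h => ⟨h.1.symm, h.2.symm⟩)⟩
  loopless := ⟨fun a h => h.elim (fun h => H.loopless.irrefl _ h) (fun h => h.2 rfl)⟩

lemma blow_adj {W : Type*} (H : SimpleGraph W) (a b : W × Fin 3) :
    (blow H).Adj a b ↔ H.Adj a.1 b.1 ∨ (a.1 = b.1 ∧ a ≠ b) := Iff.rfl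

lemma blow_matching {W : Type*} [Fintype W] (H : SimpleGraph W) (k : ℕ) (heven : Even (Fintype.card W))
    (conn : ∀ S : Finset W, S.card < k → ∀ X : Set W, (∃ a ∈ X, a ∉ S) →
      (∀ a ∈ X, a ∉ S → ∀ b, b ∉ S → H.Adj a b → b ∈ X) → ∀ b, b ∉ S → b ∈ X)
    (m : W → W) (hm : ∀ v, m (m v) = v) (hmH : ∀ v, m v = v ∨ H.Adj v (m v))
    (hfix : (univ.filter (fun v => m v = v)).card ≤ 2 * k) :
    ∃ P : (blow H).Subgraph, P.IsPerfectMatching := by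
  rw [SimpleGraph.tutte]
  intro u hu
  unfold SimpleGraph.IsTutteViolator at hu
  set R := (⊤ : (blow H).Subgraph).deleteVerts u with hR
  have hmem : ∀ a, a ∈ R.verts ↔ a ∉ u := by
    intro a; simp [hR]
  have hsame : ∀ x y : R.verts, (x.1.1 = y.1.1 ∨ H.Adj x.1.1 y.1.1) →
      R.coe.connectedComponentMk x = R.coe.connectedComponentMk y := by
    intro x y h
    by_cases hxy : x = y
    · rw [hxy]
    · apply SimpleGraph.ConnectedComponent.connectedComponentMk_eq_of_adj
      rw [SimpleGraph.Subgraph.coe_adj]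
      have h1 := (hmem x.1).1 x.2
      have h2 := (hmem y.1).1 y.2
      have h3 : (blow H).Adj x.1 y.1 := by
        rw [blow_adj]
        rcases h with h | h
        · exact Or.inr ⟨h, fun h => hxy (Subtype.ext h)⟩
        · exact Or.inl h
      simp [hR, SimpleGraph.Subgraph.deleteVerts_adj, h1, h2, h3]
  set S : Finset W := univ.filter (fun v => ∀ i, (v, i) ∈ u) with hS
  have hrem : ∀ v, v ∉ S → ∃ i, (v, i) ∉ u := by
    intro v hv
    simpa [hS] using hv
  have hnS : ∀ x : R.verts, x.1.1 ∉ S := by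
    intro x hx
    simp only [hS, mem_filter, mem_univ, true_and] at hx
    exact (hmem x.1).1 x.2 (hx x.1.2)
  by_cases hk : S.card < k
  · have hsub : ∀ x y : R.verts, R.coe.connectedComponentMk x = R.coe.connectedComponentMk y := by
      intro x y
      have := conn S hk {v | ∃ z : R.verts, z.1.1 = v ∧
        R.coe.connectedComponentMk x = R.coe.connectedComponentMk z} ⟨x.1.1, ⟨x, rfl, rfl⟩, hnS x⟩ (by
          rintro a ⟨z, rfl, hz⟩ _ b hb hab
          obtain ⟨i, hi⟩ := hrem b hb
          exact ⟨⟨(b, i), (hmem _).2 hi⟩, rfl, hz.trans (hsame _ _ (Or.inr hab))⟩) y.1.1 (hnS y)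
      obtain ⟨z, hz, h⟩ := this
      exact h.trans (hsame _ _ (Or.inl hz))
    have hss : Subsingleton R.coe.ConnectedComponent := by
      constructor
      intro a b
      induction a using SimpleGraph.ConnectedComponent.ind
      induction b using SimpleGraph.ConnectedComponent.ind
      exact hsub _ _
    have h1 : R.coe.oddComponents.ncard ≤ 1 := Set.ncard_le_one_of_subsingleton _
    have h0 : u.ncard = 0 := by omega
    have hu0 : u = ∅ := (Set.ncard_eq_zero (Set.toFinite u)).1 h0
    have hodd : Odd R.coe.oddComponents.ncard := by
      have : R.coe.oddComponents.ncard = 1 := by omega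
      rw [this]; decide
    rw [SimpleGraph.odd_ncard_oddComponents] at hodd
    have hc : Nat.card R.verts = Fintype.card W * 3 := by
      have : R.verts = Set.univ := by
        ext a; simp [hmem, hu0]
      rw [this]
      simp
    rw [hc] at hodd
    exact (Nat.not_odd_iff_even.2 (heven.mul_right 3)) hodd
  · push Not at hk
    set U : Finset (W × Fin 3) := u.toFinset with hU
    have hUc : u.ncard = U.card := Set.ncard_eq_toFinset_card' u
    set T : Finset W := univ.filter (fun v => v ∉ S ∧ ∃ i, (v, i) ∈ u) ∪
      univ.filter (fun v => m v = v) ∪ S.image m with hT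
    have hSU : S ×ˢ (univ : Finset (Fin 3)) ⊆ U := by
      rintro ⟨v, i⟩ h
      simp only [mem_product, hS, mem_filter, mem_univ, true_and, and_true] at h
      simpa [hU] using h i
    have hcU := card_sdiff_add_card_eq_card hSU
    rw [card_product] at hcU
    simp only [card_univ, Fintype.card_fin] at hcU
    have hpart : (univ.filter (fun v => v ∉ S ∧ ∃ i, (v, i) ∈ u)).card ≤
        (U \ S ×ˢ (univ : Finset (Fin 3))).card := by
      refine le_trans (card_le_card (t := (U \ S ×ˢ (univ : Finset (Fin 3))).image Prod.fst) ?_) card_image_le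
      intro v hv
      simp only [mem_filter, mem_univ, true_and] at hv
      obtain ⟨hvS, i, hi⟩ := hv
      rw [mem_image]
      exact ⟨(v, i), by simp [hU, hi, hvS], rfl⟩
    have hTc : T.card ≤ U.card := by
      have a1 := card_union_le (univ.filter (fun v => v ∉ S ∧ ∃ i, (v, i) ∈ u) ∪
        univ.filter (fun v => m v = v)) (S.image m)
      have a2 := card_union_le (univ.filter (fun v => v ∉ S ∧ ∃ i, (v, i) ∈ u))
        (univ.filter (fun v => m v = v))
      have a3 : (S.image m).card ≤ S.card := card_image_le
      rw [← hT] at a1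
      omega
    have hch : ∀ C ∈ R.coe.oddComponents, ∃ x : R.verts,
        R.coe.connectedComponentMk x = C ∧ x.1.1 ∈ T := by
      intro C hC
      by_contra! hcon
      have hC' : Odd C.supp.ncard := hC
      rw [Set.ncard_eq_toFinset_card'] at hC'
      refine (Nat.not_odd_iff_even.2 ?_) hC'
      have key : ∀ x : R.verts, R.coe.connectedComponentMk x = C →
          m x.1.1 ≠ x.1.1 ∧ m x.1.1 ∉ S ∧ ∀ i, (x.1.1, i) ∉ u := by
        intro x hx
        have h := hcon x hx
        simp only [hT, mem_union, mem_filter, mem_univ, true_and, mem_image, not_or, not_and,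
          not_exists] at h
        refine ⟨h.1.2, fun hs => h.2 _ hs (hm _), h.1.1 (hnS x)⟩
      have key2 : ∀ x : R.verts, R.coe.connectedComponentMk x = C → ∀ i,
          ∃ h : (m x.1.1, i) ∈ R.verts, R.coe.connectedComponentMk ⟨(m x.1.1, i), h⟩ = C := by
        intro x hx i
        obtain ⟨h1, h2, h3⟩ := key x hx
        have hadj := (hmH x.1.1).resolve_left h1
        obtain ⟨j, hj⟩ := hrem _ h2
        have hy : R.coe.connectedComponentMk ⟨(m x.1.1, j), (hmem _).2 hj⟩ = C := by
          rw [← hx]; exact (hsame _ _ (Or.inr hadj)).symm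
        have := (key _ hy).2.2 i
        exact ⟨(hmem _).2 this, by rw [← hy]; exact hsame _ _ (Or.inl rfl)⟩
      refine even_of_inv _ (fun x : R.verts => if h : (m x.1.1, x.1.2) ∈ R.verts then
        ⟨(m x.1.1, x.1.2), h⟩ else x) ?_ ?_ ?_
      · intro x hx
        simp only [Set.mem_toFinset, SimpleGraph.ConnectedComponent.mem_supp_iff] at hx ⊢
        obtain ⟨h, h'⟩ := key2 x hx x.1.2
        rw [dif_pos h]; exact h'
      · intro x hx
        simp only [Set.mem_toFinset, SimpleGraph.ConnectedComponent.mem_supp_iff] at hx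
        obtain ⟨h, h'⟩ := key2 x hx x.1.2
        have h2 : (m (m x.1.1), x.1.2) ∈ R.verts := by rw [hm]; exact x.2
        simp only [dif_pos h, dif_pos h2]
        apply Subtype.ext
        simp [hm]
      · intro x hx
        simp only [Set.mem_toFinset, SimpleGraph.ConnectedComponent.mem_supp_iff] at hx
        obtain ⟨h, h'⟩ := key2 x hx x.1.2
        rw [dif_pos h]
        intro he
        exact (key x hx).1 (congrArg (fun z : R.verts => z.1.1) he)
    choose g hg1 hg2 using hch
    have : R.coe.oddComponents.ncard ≤ (T : Set W).ncard := by
      rw [← Nat.card_coe_set_eq, ← Nat.card_coe_set_eq]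
      refine Nat.card_le_card_of_injective
        (fun C : R.coe.oddComponents => (⟨(g C.1 C.2).1.1, hg2 C.1 C.2⟩ : (T : Set W))) ?_
      intro C1 C2 h
      apply Subtype.ext
      rw [← hg1 C1.1 C1.2, ← hg1 C2.1 C2.2]
      exact hsame _ _ (Or.inl (congrArg (fun z : (T : Set W) => z.1) h))
    rw [Set.ncard_coe_finset] at this
    omega

lemma factor {W : Type*} [Fintype W] (H : SimpleGraph W)
    (hP : ∃ P : (blow H).Subgraph, P.IsPerfectMatching) :
    ∃ F : SimpleGraph W, F ≤ H ∧ ∀ v, Odd (dg F v) ∧ dg F v ≤ 3 := by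
  obtain ⟨P, hP⟩ := hP
  rw [SimpleGraph.Subgraph.isPerfectMatching_iff] at hP
  choose f hf huniq using hP
  have hff : ∀ a, f (f a) = a := fun a => (huniq (f a) a (hf a).symm).symm
  have hadj : ∀ a, (blow H).Adj a (f a) := fun a => (hf a).adj_sub
  have hne : ∀ a, f a ≠ a := fun a => (hadj a).ne'
  let cnt : W → W → ℕ := fun v w => (univ.filter (fun i : Fin 3 => (f (v, i)).1 = w)).card
  have hback : ∀ v w i, (f (v, i)).1 = w → f (w, (f (v, i)).2) = (v, i) := by
    rintro v w i rfl
    exact hff (v, i)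
  have hsymm : ∀ v w, cnt v w = cnt w v := by
    intro v w
    refine card_bij' (fun i _ => (f (v, i)).2) (fun i _ => (f (w, i)).2) ?_ ?_ ?_ ?_
    · intro i hi
      simp only [mem_filter, mem_univ, true_and] at *
      rw [hback v w i hi]
    · intro i hi
      simp only [mem_filter, mem_univ, true_and] at *
      rw [hback w v i hi]
    · intro i hi
      simp only [mem_filter, mem_univ, true_and] at *
      rw [hback v w i hi]
    · intro i hi
      simp only [mem_filter, mem_univ, true_and] at *
      rw [hback w v i hi]
  have hself : ∀ v, Even (cnt v v) := by
    intro v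
    refine even_of_inv _ (fun i => (f (v, i)).2) ?_ ?_ ?_
    · intro i hi
      simp only [mem_filter, mem_univ, true_and] at *
      rw [hback v v i hi]
    · intro i hi
      simp only [mem_filter, mem_univ, true_and] at *
      rw [hback v v i hi]
    · intro i hi he
      simp only [mem_filter, mem_univ, true_and] at *
      exact hne (v, i) (Prod.ext hi he)
  have hsum : ∀ v, ∑ w, cnt v w = 3 := by
    intro v
    have := card_eq_sum_card_fiberwise (f := fun i : Fin 3 => (f (v, i)).1) (s := univ)
      (t := (univ : Finset W)) (by simp [Set.MapsTo])
    simpa using this.symm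
  let F : SimpleGraph W :=
    { Adj := fun v w => Odd (cnt v w)
      symm := ⟨fun v w h => by rw [hsymm]; exact h⟩
      loopless := ⟨fun v h => (Nat.not_odd_iff_even.2 (hself v)) h⟩ }
  have hFadj : ∀ v w, F.Adj v w ↔ Odd (cnt v w) := fun _ _ => Iff.rfl
  refine ⟨F, ?_, ?_⟩
  · intro v w h
    have hvw := h.ne
    rw [hFadj] at h
    obtain ⟨i, hi⟩ := card_pos.1 h.pos
    simp only [mem_filter, mem_univ, true_and] at hi
    rcases (blow_adj H _ _).1 (hadj (v, i)) with h | h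
    · rw [hi] at h; exact h
    · exact absurd (h.1.trans hi) hvw
  · intro v
    constructor
    · have := (odd_sum_iff_odd_card_odd (s := univ) (cnt v)).1 (by rw [hsum]; decide)
      unfold dg
      convert this using 2
      ext w
      simp only [mem_filter, mem_univ, true_and, hFadj]
    · rw [← hsum v]
      unfold dg
      rw [card_filter]
      apply sum_le_sum
      intro w _
      split_ifs with h
      · exact ((hFadj v w).1 h).pos
      · exact Nat.zero_le _

lemma main {V : Type*} [Fintype V] [DecidableEq V] (G : SimpleGraph V) (k : ℕ)
    (conn : ∀ S : Finset V, S.card < 3 * k →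
      (G.induce ((Finset.univ \ S : Finset V) : Set V)).Connected)
    (p : V → V) (hp : ∀ v, p (p v) = v) (hpG : ∀ v, G.Adj v (p v))
    (D : Finset V) (hD : D.card = 2 * k) :
    ∃ F : SimpleGraph {v // v ∉ D}, (∀ a b, F.Adj a b → G.Adj a.1 b.1) ∧
      ∀ v, Odd (dg F v) ∧ dg F v ≤ 3 := by
  set H : SimpleGraph {v // v ∉ D} := G.comap Subtype.val with hH
  suffices hP : ∃ P : (blow H).Subgraph, P.IsPerfectMatching by
    obtain ⟨F, hF, h⟩ := factor H hP
    exact ⟨F, fun a b hab => hF hab, h⟩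
  refine blow_matching H k ?_ ?_ (fun v => if h : p v.1 ∉ D then ⟨p v.1, h⟩ else v) ?_ ?_ ?_
  · have h1 : Even (univ : Finset V).card :=
      even_of_inv _ p (by simp) (fun a _ => hp a) (fun a _ => (hpG a).ne')
    have h2 : Fintype.card {v // v ∉ D} = (univ : Finset V).card - D.card := by
      rw [Fintype.card_subtype_compl, Fintype.card_coe, card_univ]
    rw [h2, hD]
    exact h1.tsub (by simp)
  · intro S hS X hX hcl b hb
    obtain ⟨a, haX, haS⟩ := hX
    let E : Finset V := D ∪ S.map (Function.Embedding.subtype _)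
    have hE : E.card < 3 * k := by
      have := card_union_le D (S.map (Function.Embedding.subtype _))
      rw [card_map] at this
      change (D ∪ _).card < _
      omega
    have hmemE : ∀ c : {v // v ∉ D}, c ∉ S → c.1 ∈ ((Finset.univ \ E : Finset V) : Set V) := by
      intro c hc
      simp [E, hc, c.2]
    have hmemE' : ∀ c : V, c ∈ ((Finset.univ \ E : Finset V) : Set V) → ∃ h : c ∉ D, (⟨c, h⟩ : {v // v ∉ D}) ∉ S := by
      intro c hc
      simp only [E, coe_sdiff, coe_univ, Set.mem_sdiff, Set.mem_univ, true_and, mem_coe, mem_union, not_or, mem_map, not_exists] at hc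
      exact ⟨hc.1, fun h => hc.2 _ ⟨h, rfl⟩⟩
    have hr := (conn E hE).preconnected ⟨a.1, hmemE a haS⟩ ⟨b.1, hmemE b hb⟩
    rw [SimpleGraph.reachable_iff_reflTransGen] at hr
    have : ∃ h : b.1 ∉ D, (⟨b.1, h⟩ : {v // v ∉ D}) ∈ X := by
      refine Relation.ReflTransGen.head_induction_on (motive := fun z _ => (∃ h : z.1 ∉ D, (⟨z.1, h⟩ : {v // v ∉ D}) ∈ X) → ∃ h : b.1 ∉ D, (⟨b.1, h⟩ : {v // v ∉ D}) ∈ X) hr (fun h => h) ?_ ⟨a.2, haX⟩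
      rintro x y hxy _ ih ⟨hx, hxX⟩
      obtain ⟨hx', hxS⟩ := hmemE' x.1 x.2
      obtain ⟨hy', hyS⟩ := hmemE' y.1 y.2
      exact ih ⟨hy', hcl _ hxX hxS _ hyS hxy⟩
    exact this.2
  · intro v
    by_cases h : p v.1 ∉ D
    · have h2 : p (p v.1) ∉ D := by rw [hp]; exact v.2
      simp only [dif_pos h, dif_pos h2]
      exact Subtype.ext (hp _)
    · simp only [dif_neg h]
  · intro v
    by_cases h : p v.1 ∉ D
    · right
      simp only [dif_pos h]
      exact hpG v.1
    · left
      simp only [dif_neg h]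
  · rw [← hD]
    refine card_le_card_of_injOn (fun v => p v.1) ?_ ?_
    · intro v hv
      simp only [coe_filter, mem_univ, true_and, Set.mem_ofPred_eq] at hv
      by_contra h
      have h' : p v.1 ∉ D := h
      rw [dif_pos h'] at hv
      exact (hpG v.1).ne' (congrArg Subtype.val hv)
    · intro a _ b _ h
      apply Subtype.ext
      rw [← hp a.1, ← hp b.1]
      exact congrArg p h

end SlowDel

/-- If `k ≥ 1`, `G` is `3k`-connected on `n ≥ 4k` vertices with a perfect
matching `M`, and `D` is an independent set containing at most one endpoint of
each matching edge with `|D| ≤ 2k`, then `2·𝓈(G − D) ≥ 3n − 6k`. -/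
theorem slow_coloring_delete {V : Type*} [Fintype V] [DecidableEq V]
    (G : SimpleGraph V) (k : ℕ) (hk : 1 ≤ k)
    (hconn : G.MConnected (3 * k)) (hn : 4 * k ≤ Fintype.card V)
    (M : G.Subgraph) (hM : M.IsPerfectMatching)
    (D : Finset V) (hind : ∀ u ∈ D, ∀ v ∈ D, ¬ G.Adj u v)
    (hDM : ∀ u v : V, M.Adj u v → u ∈ D → v ∉ D)
    (hD : D.card ≤ 2 * k) :
    3 * Fintype.card V ≤
      2 * (G.induce ((Finset.univ \ D : Finset V) : Set V)).sumColorCost + 6 * k := by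
  classical
  rw [SimpleGraph.Subgraph.isPerfectMatching_iff] at hM
  choose p hp huniq using hM
  have hpp : ∀ v, p (p v) = v := fun v => (huniq (p v) v (hp v).symm).symm
  obtain ⟨D', hDD', -, hD'⟩ := Finset.exists_subsuperset_card_eq (Finset.subset_univ D) hD
    (by rw [Finset.card_univ]; omega)
  obtain ⟨F1, hF1, hF1d⟩ := SlowDel.main G k hconn.2 p hpp (fun v => (hp v).adj_sub) D' hD'
  let F0 : SimpleGraph ((Finset.univ \ D : Finset V) : Set V) :=
    { Adj := fun a b => ∃ (ha : a.1 ∉ D') (hb : b.1 ∉ D'), F1.Adj ⟨a.1, ha⟩ ⟨b.1, hb⟩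
      symm := ⟨fun a b ⟨ha, hb, h⟩ => ⟨hb, ha, h.symm⟩⟩
      loopless := ⟨fun a ⟨_, _, h⟩ => F1.loopless.irrefl _ h⟩ }
  obtain ⟨F, hFadj⟩ : ∃ F : SimpleGraph ((Finset.univ \ D : Finset V) : Set V), ∀ a b, F.Adj a b ↔
      ∃ (ha : a.1 ∉ D') (hb : b.1 ∉ D'), F1.Adj ⟨a.1, ha⟩ ⟨b.1, hb⟩ := ⟨F0, fun _ _ => Iff.rfl⟩
  clear F0
  have hd1 : ∀ (a : ((Finset.univ \ D : Finset V) : Set V)) (ha : a.1 ∉ D'), SlowDel.dg F a = SlowDel.dg F1 ⟨a.1, ha⟩ := by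
    intro a ha
    unfold SlowDel.dg
    have hmem : ∀ w : {v // v ∉ D'}, w.1 ∈ ((Finset.univ \ D : Finset V) : Set V) := by
      intro w
      have := fun h => w.2 (hDD' h)
      simpa  using this
    symm
    refine Finset.card_bij (fun w _ => ⟨w.1, hmem w⟩) ?_ ?_ ?_
    · intro w hw
      simp only [Finset.mem_filter, Finset.mem_univ, true_and] at *
      exact (hFadj _ _).2 ⟨ha, w.2, hw⟩
    · intro w _ w' _ h
      exact Subtype.ext (congrArg (fun z : ((Finset.univ \ D : Finset V) : Set V) => z.1) h)
    · intro b hb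
      simp only [Finset.mem_filter, Finset.mem_univ, true_and] at hb
      obtain ⟨_, hb', h⟩ := (hFadj _ _).1 hb
      exact ⟨⟨b.1, hb'⟩, by simpa using h, rfl⟩
  have hd0 : ∀ a : ((Finset.univ \ D : Finset V) : Set V), a.1 ∈ D' → SlowDel.dg F a = 0 := by
    intro a ha
    unfold SlowDel.dg
    rw [Finset.card_eq_zero, Finset.filter_eq_empty_iff]
    intro w _ h
    exact ((hFadj _ _).1 h).1 ha
  have hg := SlowDel.game (G.induce ((Finset.univ \ D : Finset V) : Set V)) (Fintype.card ((Finset.univ \ D : Finset V) : Set V)) Finset.univ F Finset.card_univ.le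
    (fun a b h => hF1 _ _ ((hFadj _ _).1 h).2.2) (by simp) (by
      intro a
      by_cases ha : a.1 ∈ D'
      · rw [hd0 a ha]; omega
      · rw [hd1 a ha]; exact (hF1d _).2)
  have hev : SlowDel.ev F Finset.univ ≤ (D' \ D).card := by
    unfold SlowDel.ev
    refine Finset.card_le_card_of_injOn (fun a => a.1) ?_ (fun a _ b _ h => Subtype.ext h)
    intro a ha
    simp only [Finset.coe_filter, Finset.mem_univ, true_and, Set.mem_ofPred_eq] at ha
    have haD : a.1 ∉ D := by
      have := a.2
      simpa  using this
    by_cases h : a.1 ∈ D'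
    · simp [h, haD]
    · rw [hd1 a h] at ha
      exact absurd (hF1d ⟨a.1, h⟩).1 (Nat.not_odd_iff_even.2 ha)
  have hcW : Fintype.card ((Finset.univ \ D : Finset V) : Set V) + D.card = Fintype.card V := by
    have h1 : Fintype.card ((Finset.univ \ D : Finset V) : Set V) = (Finset.univ \ D : Finset V).card := by
      rw [← Set.toFinset_card, Finset.toFinset_coe]
    rw [h1, ← Finset.card_univ (α := V)]
    exact Finset.card_sdiff_add_card_eq_card (Finset.subset_univ D)
  have hcD := Finset.card_sdiff_add_card_eq_card hDD'
  rw [Finset.card_univ] at hg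
  have hg' : 3 * Fintype.card ((Finset.univ \ D : Finset V) : Set V) ≤ 2 * (G.induce ((Finset.univ \ D : Finset V) : Set V)).sumColorCost + SlowDel.ev F Finset.univ := by
    unfold SimpleGraph.sumColorCost
    convert hg
  omega
end
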